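/- Assume 1/4 < s' ≤ 1, 1/2 < s ≤ 1, max(3/2 − 2s, s/2 − 1/8) < s' < 4s − 3/2, 1/2 < θ₀ < 3/4, and max(1/2, 1 − s') < θ₁ < min(3/4, 4s − s' − 1, 2s − 1/2). Then there exists ε₀ > 0 such that for every ε with 0 < ε ≤ ε₀ there exists a constant C > 0 such that for all Schwartz functions u, v on ℝ^{1+2}, ‖uv‖_{H^{s−1/2, θ₀−1/2+ε}} ≤ C ‖u‖_{H^{s−1/2, θ₀}} ‖v‖_{H^{s'+1/2, θ₁}}. -/

import Mathlib

open MeasureTheory Real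
open scoped FourierTransform

noncomputable section

/-- Space-time ℝ^{1+2}: coordinate 0 is time `t`, coordinates 1,2 are space `x`. -/
abbrev SpaceTime := EuclideanSpace ℝ (Fin 3)

/-- The magnitude `|ξ|` of the spatial part of a frequency point `(τ, ξ) ∈ ℝ × ℝ²`. -/
def spFreq (ζ : SpaceTime) : ℝ := Real.sqrt ((ζ 1) ^ 2 + (ζ 2) ^ 2)

/-- The wave-Sobolev norm
`‖u‖_{H^{s,b}} = (∫ (1+|ξ|²)^s (1+||τ|-|ξ||)^{2b} |û(τ,ξ)|² dτ dξ)^{1/2}`. -/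
def waveNorm (s b : ℝ) (f : SpaceTime → ℂ) : ℝ :=
  (∫ ζ : SpaceTime, (1 + (spFreq ζ) ^ 2) ^ s * (1 + |(|ζ 0| - spFreq ζ)|) ^ (2 * b) *
    ‖𝓕 f ζ‖ ^ 2) ^ (1/2 : ℝ)

section BilinearEstimate

open Set
open scoped ENNReal

/-- The `L²` size of a nonnegative function. -/
def l2Size {α : Type*} [MeasurableSpace α] (μ : Measure α) (f : α → ℝ≥0∞) : ℝ≥0∞ :=
  (∫⁻ x, f x ^ 2 ∂μ) ^ (1 / 2 : ℝ)

theorem l2Size_sq {α : Type*} [MeasurableSpace α] (μ : Measure α) (f : α → ℝ≥0∞) :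
    l2Size μ f ^ 2 = ∫⁻ x, f x ^ 2 ∂μ := by
  rw [l2Size, ← ENNReal.rpow_natCast, ← ENNReal.rpow_mul]
  norm_num

theorem ENNReal.sq_rpow_half (a : ℝ≥0∞) : (a ^ 2) ^ (1 / 2 : ℝ) = a := by
  rw [← ENNReal.rpow_natCast, ← ENNReal.rpow_mul]
  norm_num

theorem ENNReal.rpow_half_sq (a : ℝ≥0∞) : (a ^ (1 / 2 : ℝ)) ^ 2 = a := by
  rw [← ENNReal.rpow_natCast, ← ENNReal.rpow_mul]
  norm_num

theorem lintegral_mul_le_l2Size {α : Type*} [MeasurableSpace α] (μ : Measure α)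
    {f g : α → ℝ≥0∞} (hf : AEMeasurable f μ) (hg : AEMeasurable g μ) :
    ∫⁻ x, f x * g x ∂μ ≤ l2Size μ f * l2Size μ g := by
  have h := ENNReal.lintegral_mul_le_Lp_mul_Lq μ Real.HolderConjugate.two_two hf hg
  simpa [l2Size, Pi.mul_apply] using h

theorem tsum_mul_le_l2 {ι : Type*} [Countable ι] (f g : ι → ℝ≥0∞) :
    ∑' i, f i * g i ≤ (∑' i, f i ^ 2) ^ (1 / 2 : ℝ) * (∑' i, g i ^ 2) ^ (1 / 2 : ℝ) := by
  let _ : MeasurableSpace ι := ⊤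
  have h := lintegral_mul_le_l2Size (Measure.count : Measure ι) (f := f) (g := g)
    (measurable_from_top.aemeasurable) (measurable_from_top.aemeasurable)
  simpa [l2Size, lintegral_count] using h

section Trilinear

variable {G : Type*} [MeasurableSpace G] [AddCommGroup G] [MeasurableAdd₂ G] [MeasurableNeg G]
  [MeasurableSub₂ G] (μ : Measure G) [SFinite μ] [μ.IsAddLeftInvariant] [μ.IsNegInvariant]

/-- The trilinear form `∫∫ √Q(x, y) h(x) f(x - y) g(y) dy dx`. -/
def triForm (Q : G → G → ℝ≥0∞) (h f g : G → ℝ≥0∞) : ℝ≥0∞ :=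
  ∫⁻ x, ∫⁻ y, Q x y ^ (1 / 2 : ℝ) * (h x * f (x - y) * g y) ∂μ ∂μ

variable {μ} {Q : G → G → ℝ≥0∞} {h f g : G → ℝ≥0∞}

omit [MeasurableNeg G] [μ.IsNegInvariant] in
/-- Cauchy–Schwarz: the trilinear form is bounded when `∫ Q(x, y) dy` is bounded in `x`. -/
theorem triForm_le (hQ : Measurable (Function.uncurry Q)) (hh : Measurable h) (hf : Measurable f)
    (hg : Measurable g) (D : ℝ≥0∞) (hD : ∀ᵐ x ∂μ, ∫⁻ y, Q x y ∂μ ≤ D) :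
    triForm μ Q h f g ≤ D ^ (1 / 2 : ℝ) * (l2Size μ h * l2Size μ f * l2Size μ g) := by
  have hQx (x : G) : Measurable (Q x) := hQ.comp measurable_prodMk_left
  have key : ∀ᵐ x ∂μ, ∫⁻ y, Q x y ^ (1 / 2 : ℝ) * (h x * f (x - y) * g y) ∂μ ≤
      D ^ (1 / 2 : ℝ) * (h x * l2Size μ (fun y => f (x - y) * g y)) := by
    filter_upwards [hD] with x hx
    calc ∫⁻ y, Q x y ^ (1 / 2 : ℝ) * (h x * f (x - y) * g y) ∂μ
        = ∫⁻ y, h x * (Q x y ^ (1 / 2 : ℝ) * (f (x - y) * g y)) ∂μ := by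
          congr 1; ext y; ring
      _ = h x * ∫⁻ y, Q x y ^ (1 / 2 : ℝ) * (f (x - y) * g y) ∂μ := by
          have := hQx x
          rw [lintegral_const_mul _ (by fun_prop)]
      _ ≤ h x * (l2Size μ (fun y => Q x y ^ (1 / 2 : ℝ)) *
            l2Size μ (fun y => f (x - y) * g y)) := by
          gcongr
          apply lintegral_mul_le_l2Size
          · exact ((hQx x).pow_const _).aemeasurable
          · fun_prop
      _ ≤ h x * (D ^ (1 / 2 : ℝ) * l2Size μ (fun y => f (x - y) * g y)) := by
          gcongr
          rw [l2Size]
          simp_rw [ENNReal.rpow_half_sq]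
          gcongr
      _ = _ := by ring
  have hmeas : Measurable fun x => l2Size μ (fun y => f (x - y) * g y) := by
    unfold l2Size
    apply Measurable.pow_const
    apply Measurable.lintegral_prod_right'
      (f := fun p : G × G => (f (p.1 - p.2) * g p.2) ^ 2)
    fun_prop
  calc triForm μ Q h f g
      ≤ ∫⁻ x, D ^ (1 / 2 : ℝ) * (h x * l2Size μ (fun y => f (x - y) * g y)) ∂μ :=
        lintegral_mono_ae key
    _ = D ^ (1 / 2 : ℝ) * ∫⁻ x, h x * l2Size μ (fun y => f (x - y) * g y) ∂μ := by
        rw [lintegral_const_mul]; fun_prop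
    _ ≤ D ^ (1 / 2 : ℝ) * (l2Size μ h *
          l2Size μ fun x => l2Size μ (fun y => f (x - y) * g y)) := by
        gcongr
        exact lintegral_mul_le_l2Size μ hh.aemeasurable hmeas.aemeasurable
    _ = _ := by
        rw [mul_assoc (l2Size μ h)]
        congr 2
        rw [l2Size]
        simp_rw [l2Size_sq]
        rw [lintegral_lintegral_swap]
        · have : ∀ y, ∫⁻ x, (f (x - y) * g y) ^ 2 ∂μ = (∫⁻ x, f x ^ 2 ∂μ) * g y ^ 2 := by
            intro y
            simp_rw [mul_pow]
            rw [lintegral_mul_const _ (by fun_prop)]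
            rw [lintegral_sub_right_eq_self (fun x => f x ^ 2) y]
          simp_rw [this]
          rw [lintegral_const_mul _ (by fun_prop), ENNReal.mul_rpow_of_nonneg _ _ (by norm_num)]
          rfl
        · apply Measurable.aemeasurable
          show Measurable fun p : G × G => (f (p.1 - p.2) * g p.2) ^ 2
          fun_prop

omit [MeasurableSub₂ G] [SFinite μ] in
theorem triForm_comm (Q : G → G → ℝ≥0∞) (h f g : G → ℝ≥0∞) :
    triForm μ (fun x y => Q x (x - y)) h f g = triForm μ Q h g f := by
  unfold triForm
  congr 1; ext x
  rw [← lintegral_sub_left_eq_self (fun y => Q x y ^ (1 / 2 : ℝ) * (h x * g (x - y) * f y)) x]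
  congr 1; ext y
  simp only [sub_sub_cancel]
  ring

omit [MeasurableAdd₂ G] [MeasurableNeg G] [μ.IsAddLeftInvariant] [μ.IsNegInvariant] in
/-- Countable subadditivity of the trilinear form, in terms of pointwise domination of the
integrands. -/
theorem triForm_le_tsum {ι : Type*} [Countable ι] {Q' : ι → G → G → ℝ≥0∞}
    {f' g' : ι → G → ℝ≥0∞} (hQ : ∀ i, Measurable (Function.uncurry (Q' i))) (hh : Measurable h)
    (hf : ∀ i, Measurable (f' i)) (hg : ∀ i, Measurable (g' i))
    (hle : ∀ᵐ x ∂μ, ∀ y, ∃ i, Q x y * (f (x - y) * g y) ^ 2 ≤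
      Q' i x y * (f' i (x - y) * g' i y) ^ 2) :
    triForm μ Q h f g ≤ ∑' i, triForm μ (Q' i) h (f' i) (g' i) := by
  unfold triForm
  have hQ' (i : ι) : Measurable fun p : G × G => Q' i p.1 p.2 := hQ i
  have hm (i : ι) : Measurable fun p : G × G =>
      Q' i p.1 p.2 ^ (1 / 2 : ℝ) * (h p.1 * f' i (p.1 - p.2) * g' i p.2) := by
    have := hQ' i; have := hf i; have := hg i
    fun_prop
  rw [← lintegral_tsum fun i => (hm i).lintegral_prod_right'.aemeasurable]
  apply lintegral_mono_ae
  filter_upwards [hle] with x hx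
  have hmx (i : ι) : Measurable fun y =>
      Q' i x y ^ (1 / 2 : ℝ) * (h x * f' i (x - y) * g' i y) :=
    (hm i).comp measurable_prodMk_left
  rw [← lintegral_tsum fun i => (hmx i).aemeasurable]
  refine lintegral_mono fun y => ?_
  obtain ⟨i, hi⟩ := hx y
  refine le_trans ?_ (ENNReal.le_tsum i)
  have h2 := ENNReal.rpow_le_rpow hi (z := 1 / 2) (by norm_num)
  rw [ENNReal.mul_rpow_of_nonneg _ _ (by norm_num), ENNReal.mul_rpow_of_nonneg _ _ (by norm_num),
    ENNReal.sq_rpow_half, ENNReal.sq_rpow_half] at h2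
  calc Q x y ^ (1 / 2 : ℝ) * (h x * f (x - y) * g y)
      = h x * (Q x y ^ (1 / 2 : ℝ) * (f (x - y) * g y)) := by ring
    _ ≤ h x * (Q' i x y ^ (1 / 2 : ℝ) * (f' i (x - y) * g' i y)) := by gcongr
    _ = _ := by ring

omit [MeasurableNeg G] [μ.IsNegInvariant] in
/-- Cauchy–Schwarz with almost orthogonality: if the kernel only couples points at which the
values of `q` differ by at most `L`, it is enough to bound `∫ Q(x, y) dy` over shells of
width `L`. -/
theorem triForm_le_of_shell (hQ : Measurable (Function.uncurry Q)) (hh : Measurable h)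
    (hf : Measurable f) (hg : Measurable g) {q : G → ℝ} (hq : Measurable q) {L : ℝ} (hL : 0 < L)
    (hsupp : ∀ x y, Q x y ≠ 0 → |q (x - y) - q y| ≤ L) (D : ℝ≥0∞)
    (hD : ∀ᵐ x ∂μ, ∀ a : ℝ, ∫⁻ y in {y | a ≤ q y ∧ q y ≤ a + L}, Q x y ∂μ ≤ D) :
    triForm μ Q h f g ≤ 2 * D ^ (1 / 2 : ℝ) * (l2Size μ h * l2Size μ f * l2Size μ g) := by
  set n : G → ℤ := fun y => ⌊q y / L⌋ with hn
  have hnm : Measurable n := by fun_prop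
  have hset (k : ℤ) : MeasurableSet {y | n y = k} := hnm (measurableSet_singleton k)
  have hset' (k : ℤ) : MeasurableSet {y | |n y - k| ≤ 1} :=
    hnm (MeasurableSet.of_discrete (s := {m : ℤ | |m - k| ≤ 1}))
  set Q' : ℤ → G → G → ℝ≥0∞ := fun k x y => {y | n y = k}.indicator (Q x) y with hQ'
  set f' : ℤ → G → ℝ≥0∞ := fun k => {y | |n y - k| ≤ 1}.indicator f with hf'
  set g' : ℤ → G → ℝ≥0∞ := fun k => {y | n y = k}.indicator g with hg'
  have hQ'm (k : ℤ) : Measurable (Function.uncurry (Q' k)) :=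
    hQ.indicator (s := Prod.snd ⁻¹' {y | n y = k}) (measurable_snd (hset k))
  have hf'm (k : ℤ) : Measurable (f' k) := hf.indicator (hset' k)
  have hg'm (k : ℤ) : Measurable (g' k) := hg.indicator (hset k)
  have hdecomp : triForm μ Q h f g ≤ ∑' k, triForm μ (Q' k) h (f' k) (g' k) := by
    refine triForm_le_tsum hQ'm hh hf'm hg'm (Filter.Eventually.of_forall fun x y => ⟨n y, ?_⟩)
    by_cases h0 : Q x y = 0
    · simp [h0]
    have hclose : |n (x - y) - n y| ≤ 1 := by
      have h1 := abs_le.1 (hsupp x y h0)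
      have e : q (x - y) / L - q y / L = (q (x - y) - q y) / L := by ring
      have h2 : q (x - y) / L - q y / L ≤ 1 := by
        rw [e, div_le_one hL]; exact h1.2
      have h3 : -1 ≤ q (x - y) / L - q y / L := by
        rw [e, le_div_iff₀ hL]; linarith [h1.1]
      have a1 := Int.floor_le (q (x - y) / L)
      have a2 := Int.lt_floor_add_one (q (x - y) / L)
      have b1 := Int.floor_le (q y / L)
      have b2 := Int.lt_floor_add_one (q y / L)
      have c1 : ((n (x - y) : ℤ) : ℝ) < n y + 2 := by simp only [hn]; linarith
      have c2 : ((n y : ℤ) : ℝ) < n (x - y) + 2 := by simp only [hn]; linarith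
      rw [abs_le]
      constructor
      · have : n y < n (x - y) + 2 := by exact_mod_cast c2
        omega
      · have : n (x - y) < n y + 2 := by exact_mod_cast c1
        omega
    simp [hQ', hf', hg', hclose]
  have hpiece (k : ℤ) : triForm μ (Q' k) h (f' k) (g' k) ≤
      D ^ (1 / 2 : ℝ) * (l2Size μ h * l2Size μ (f' k) * l2Size μ (g' k)) := by
    refine triForm_le (hQ'm k) hh (hf'm k) (hg'm k) D ?_
    filter_upwards [hD] with x hx
    refine le_trans ?_ (hx (k * L))
    rw [lintegral_indicator (hset k)]
    refine lintegral_mono_set fun y hy => ?_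
    have hy' : ⌊q y / L⌋ = k := hy
    have a1 := Int.floor_le (q y / L)
    have a2 := Int.lt_floor_add_one (q y / L)
    rw [hy'] at a1 a2
    rw [le_div_iff₀ hL] at a1
    rw [div_lt_iff₀ hL] at a2
    constructor <;> linarith
  have hsumf : ∑' k, l2Size μ (f' k) ^ 2 ≤ 3 * l2Size μ f ^ 2 := by
    simp_rw [l2Size_sq]
    rw [← lintegral_tsum fun k => ((hf'm k).pow_const 2).aemeasurable,
      ← lintegral_const_mul _ (hf.pow_const 2)]
    refine lintegral_mono fun y => ?_
    calc ∑' k, f' k y ^ 2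
        ≤ ∑' k, ((if k = n y - 1 then f y ^ 2 else 0) + (if k = n y then f y ^ 2 else 0) +
            (if k = n y + 1 then f y ^ 2 else 0)) := by
          refine ENNReal.tsum_le_tsum fun k => ?_
          by_cases hk : |n y - k| ≤ 1
          · have : k = n y - 1 ∨ k = n y ∨ k = n y + 1 := by
              rw [abs_le] at hk; omega
            rcases this with rfl | rfl | rfl <;> simp [hf']
          · simp [hf', hk]
      _ = 3 * f y ^ 2 := by
          rw [ENNReal.tsum_add, ENNReal.tsum_add]
          simp only [tsum_ite_eq]
          ring
  have hsumg : ∑' k, l2Size μ (g' k) ^ 2 ≤ l2Size μ g ^ 2 := by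
    simp_rw [l2Size_sq]
    rw [← lintegral_tsum fun k => ((hg'm k).pow_const 2).aemeasurable]
    refine lintegral_mono fun y => ?_
    calc ∑' k, g' k y ^ 2 ≤ ∑' k, (if k = n y then g y ^ 2 else 0) := by
          refine ENNReal.tsum_le_tsum fun k => ?_
          by_cases hk : k = n y
          · simp [hg', hk]
          · simp [hg', hk, Ne.symm hk]
      _ ≤ g y ^ 2 := by simp
  calc triForm μ Q h f g
      ≤ ∑' k, D ^ (1 / 2 : ℝ) * l2Size μ h * (l2Size μ (f' k) * l2Size μ (g' k)) := by
        refine hdecomp.trans (ENNReal.tsum_le_tsum fun k => (hpiece k).trans_eq (by ring))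
    _ ≤ D ^ (1 / 2 : ℝ) * l2Size μ h * ((3 * l2Size μ f ^ 2) ^ (1 / 2 : ℝ) *
          (l2Size μ g ^ 2) ^ (1 / 2 : ℝ)) := by
        rw [ENNReal.tsum_mul_left]
        gcongr
        refine (tsum_mul_le_l2 _ _).trans ?_
        gcongr
    _ ≤ D ^ (1 / 2 : ℝ) * l2Size μ h * ((2 ^ 2 * l2Size μ f ^ 2) ^ (1 / 2 : ℝ) *
          (l2Size μ g ^ 2) ^ (1 / 2 : ℝ)) := by
        gcongr
        norm_num
    _ = _ := by
        rw [← mul_pow, ENNReal.sq_rpow_half, ENNReal.sq_rpow_half]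
        ring

variable (μ) in
/-- `√Q` is the kernel of a bounded trilinear form on `L² × L² × L²`. -/
def TriBounded (Q : G → G → ℝ≥0∞) : Prop :=
  ∃ C : ℝ≥0∞, C ≠ ∞ ∧ ∀ h f g : G → ℝ≥0∞, Measurable h → Measurable f → Measurable g →
    triForm μ Q h f g ≤ C * (l2Size μ h * l2Size μ f * l2Size μ g)

omit [MeasurableNeg G] [μ.IsNegInvariant] in
theorem TriBounded.of_lintegral_le (hQ : Measurable (Function.uncurry Q)) {D : ℝ≥0∞}
    (hDt : D ≠ ∞) (hD : ∀ᵐ x ∂μ, ∫⁻ y, Q x y ∂μ ≤ D) : TriBounded μ Q :=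
  ⟨D ^ (1 / 2 : ℝ), ENNReal.rpow_ne_top_of_nonneg (by norm_num) hDt,
    fun _ _ _ hh hf hg => triForm_le hQ hh hf hg D hD⟩

omit [MeasurableAdd₂ G] [MeasurableNeg G] [MeasurableSub₂ G] [SFinite μ]
  [μ.IsAddLeftInvariant] [μ.IsNegInvariant] in
theorem TriBounded.mono {Q' : G → G → ℝ≥0∞} (hQ' : TriBounded μ Q')
    (hle : ∀ᵐ x ∂μ, ∀ y, Q x y ≤ Q' x y) : TriBounded μ Q := by
  obtain ⟨C, hC, hb⟩ := hQ'
  refine ⟨C, hC, fun h f g hh hf hg => le_trans ?_ (hb h f g hh hf hg)⟩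
  refine lintegral_mono_ae ?_
  filter_upwards [hle] with x hx
  refine lintegral_mono fun y => ?_
  gcongr
  exact hx y

omit [MeasurableSub₂ G] [SFinite μ] in
theorem TriBounded.comm (hQ : TriBounded μ Q) : TriBounded μ fun x y => Q x (x - y) := by
  obtain ⟨C, hC, hb⟩ := hQ
  refine ⟨C, hC, fun h f g hh hf hg => ?_⟩
  rw [triForm_comm]
  exact (hb h g f hh hg hf).trans_eq (by ring)

omit [MeasurableAdd₂ G] [MeasurableNeg G] [μ.IsAddLeftInvariant] [μ.IsNegInvariant] in
theorem TriBounded.add {Q' : G → G → ℝ≥0∞} (hQm : Measurable (Function.uncurry Q))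
    (hQ : TriBounded μ Q) (hQ' : TriBounded μ Q') : TriBounded μ fun x y => Q x y + Q' x y := by
  obtain ⟨C, hC, hb⟩ := hQ
  obtain ⟨C', hC', hb'⟩ := hQ'
  refine ⟨C + C', ENNReal.add_ne_top.2 ⟨hC, hC'⟩, fun h f g hh hf hg => ?_⟩
  rw [add_mul]
  refine le_trans ?_ (add_le_add (hb h f g hh hf hg) (hb' h f g hh hf hg))
  have hQp : Measurable fun p : G × G => Q p.1 p.2 := hQm
  have hm : Measurable fun p : G × G =>
      Q p.1 p.2 ^ (1 / 2 : ℝ) * (h p.1 * f (p.1 - p.2) * g p.2) := by fun_prop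
  unfold triForm
  rw [← lintegral_add_left hm.lintegral_prod_right']
  refine lintegral_mono fun x => ?_
  have hmx : Measurable fun y => Q x y ^ (1 / 2 : ℝ) * (h x * f (x - y) * g y) :=
    hm.comp measurable_prodMk_left
  dsimp only
  rw [← lintegral_add_left hmx]
  refine lintegral_mono fun y => ?_
  rw [← add_mul]
  gcongr
  exact ENNReal.rpow_add_le_add_rpow _ _ (by norm_num) (by norm_num)

omit [MeasurableAdd₂ G] [MeasurableNeg G] [MeasurableSub₂ G] [SFinite μ]
  [μ.IsAddLeftInvariant] [μ.IsNegInvariant] in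
theorem TriBounded.const_mul (hQ : TriBounded μ Q) {c : ℝ≥0∞} (hc : c ≠ ∞) :
    TriBounded μ fun x y => c * Q x y := by
  obtain ⟨C, hC, hb⟩ := hQ
  have hc' : c ^ (1 / 2 : ℝ) ≠ ∞ := ENNReal.rpow_ne_top_of_nonneg (by norm_num) hc
  refine ⟨c ^ (1 / 2 : ℝ) * C, ENNReal.mul_ne_top hc' hC, fun h f g hh hf hg => ?_⟩
  rw [mul_assoc]
  refine le_trans (le_of_eq ?_) (mul_le_mul_right (hb h f g hh hf hg) _)
  unfold triForm
  rw [← lintegral_const_mul' _ _ hc']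
  congr 1; ext x
  rw [← lintegral_const_mul' _ _ hc']
  congr 1; ext y
  rw [ENNReal.mul_rpow_of_nonneg _ _ (by norm_num)]
  ring

end Trilinear

/-- Density of the change of variables `z ↦ (‖z‖, ‖z₀ - z‖)` in the plane, where `M = ‖z₀‖`. -/
def bipolarDensity (M r ρ : ℝ) : ℝ :=
  4 * r * ρ / (√((r + ρ) ^ 2 - M ^ 2) * √(M ^ 2 - (ρ - r) ^ 2))

theorem lintegral_angle_le {M r : ℝ} (hM : 0 < M) (hr : 0 < r) (F : ℝ → ℝ≥0∞) :
    ∫⁻ θ in Ioo 0 π, F √(r ^ 2 + M ^ 2 - 2 * r * M * cos θ) ≤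
      ∫⁻ ρ in Ioo |r - M| (r + M),
        ENNReal.ofReal (2 * ρ / (√((r + ρ) ^ 2 - M ^ 2) * √(M ^ 2 - (ρ - r) ^ 2))) * F ρ := by
  set f : ℝ → ℝ := fun θ => √(r ^ 2 + M ^ 2 - 2 * r * M * cos θ) with hf
  have hrM : 0 < r * M := mul_pos hr hM
  have hcos : ∀ θ ∈ Ioo 0 π, -1 < cos θ ∧ cos θ < 1 := by
    intro θ hθ
    constructor
    · rw [← cos_pi]
      exact cos_lt_cos_of_nonneg_of_le_pi hθ.1.le le_rfl hθ.2
    · rw [← cos_zero]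
      exact cos_lt_cos_of_nonneg_of_le_pi le_rfl hθ.2.le hθ.1
  have hpos : ∀ θ ∈ Ioo 0 π, (r - M) ^ 2 < r ^ 2 + M ^ 2 - 2 * r * M * cos θ := by
    intro θ hθ
    nlinarith [(hcos θ hθ).2]
  have hpos' : ∀ θ ∈ Ioo 0 π, r ^ 2 + M ^ 2 - 2 * r * M * cos θ < (r + M) ^ 2 := by
    intro θ hθ
    nlinarith [(hcos θ hθ).1]
  have hderiv : ∀ θ ∈ Ioo 0 π,
      HasDerivWithinAt f (r * M * sin θ / f θ) (Ioo 0 π) θ := by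
    intro θ hθ
    have h0 : r ^ 2 + M ^ 2 - 2 * r * M * cos θ ≠ 0 := by nlinarith [hpos θ hθ, sq_nonneg (r - M)]
    have h1 : HasDerivAt (fun θ => r ^ 2 + M ^ 2 - 2 * r * M * cos θ)
        (-(2 * r * M * (-sin θ))) θ := ((hasDerivAt_cos θ).const_mul _).const_sub _
    have e : r * M * sin θ / f θ =
        -(2 * r * M * (-sin θ)) / (2 * √(r ^ 2 + M ^ 2 - 2 * r * M * cos θ)) := by
      have : √(r ^ 2 + M ^ 2 - 2 * r * M * cos θ) ≠ 0 := by
        rw [Real.sqrt_ne_zero']; nlinarith [hpos θ hθ, sq_nonneg (r - M)]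
      simp only [hf]
      field_simp
    rw [e]
    exact (h1.sqrt h0).hasDerivWithinAt
  have hinj : InjOn f (Ioo 0 π) := by
    intro a ha b hb hab
    have h1 := (Real.sqrt_inj (by nlinarith [hpos a ha, sq_nonneg (r - M)])
      (by nlinarith [hpos b hb, sq_nonneg (r - M)])).1 hab
    have h2 : cos a = cos b := by
      have : r * M * (cos a - cos b) = 0 := by linarith
      rcases mul_eq_zero.1 this with h | h
      · exact absurd h hrM.ne'
      · linarith
    exact injOn_cos ⟨ha.1.le, ha.2.le⟩ ⟨hb.1.le, hb.2.le⟩ h2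
  have himage : f '' Ioo 0 π ⊆ Ioo |r - M| (r + M) := by
    rintro _ ⟨θ, hθ, rfl⟩
    constructor
    · rw [← Real.sqrt_sq_eq_abs]
      exact Real.sqrt_lt_sqrt (sq_nonneg _) (hpos θ hθ)
    · rw [Real.sqrt_lt' (by positivity)]
      exact hpos' θ hθ
  refine le_trans (le_of_eq ?_) (lintegral_mono_set himage)
  rw [lintegral_image_eq_lintegral_abs_deriv_mul measurableSet_Ioo hderiv hinj]
  refine setLIntegral_congr_fun measurableSet_Ioo fun θ hθ => ?_
  have hfpos : 0 < f θ := Real.sqrt_pos.2 (by nlinarith [hpos θ hθ, sq_nonneg (r - M)])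
  have hfsq : f θ ^ 2 = r ^ 2 + M ^ 2 - 2 * r * M * cos θ :=
    Real.sq_sqrt (by nlinarith [hpos θ hθ, sq_nonneg (r - M)])
  have hsin : 0 < sin θ := sin_pos_of_pos_of_lt_pi hθ.1 hθ.2
  have hup : 0 ≤ (r + f θ) ^ 2 - M ^ 2 := by
    have := (himage ⟨θ, hθ, rfl⟩).1
    have h2 := (abs_lt.1 this)
    nlinarith [h2.1, h2.2]
  have hprod : √((r + f θ) ^ 2 - M ^ 2) * √(M ^ 2 - (f θ - r) ^ 2) = 2 * r * M * sin θ := by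
    rw [← Real.sqrt_mul hup, Real.sqrt_eq_iff_mul_self_eq_of_pos (by positivity)]
    have e : ((r + f θ) ^ 2 - M ^ 2) * (M ^ 2 - (f θ - r) ^ 2) =
        4 * r ^ 2 * M ^ 2 - (r ^ 2 + M ^ 2 - f θ ^ 2) ^ 2 := by ring
    rw [e, hfsq]
    have := sin_sq_add_cos_sq θ
    linear_combination (4 * r ^ 2 * M ^ 2) * this
  rw [← mul_assoc, ← ENNReal.ofReal_mul (abs_nonneg _), hprod, abs_of_pos (by positivity)]
  have : r * M * sin θ / f θ * (2 * f θ / (2 * r * M * sin θ)) = 1 := by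
    field_simp
  rw [this]
  simp [hf]

theorem lintegral_bipolar_le {M : ℝ} (hM : 0 < M) {z₀ : ℂ} (hz₀ : ‖z₀‖ = M)
    {F : ℝ → ℝ → ℝ≥0∞} (hF : Measurable (Function.uncurry F)) :
    ∫⁻ z : ℂ, F ‖z‖ ‖z₀ - z‖ ≤
      ∫⁻ r in Ioi 0, ∫⁻ ρ in Ioo |r - M| (r + M),
        ENNReal.ofReal (bipolarDensity M r ρ) * F r ρ := by
  have hF2 : Measurable fun p : ℝ × ℝ => F p.1 p.2 := hF
  set c : Circle := Circle.exp z₀.arg with hc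
  have hcz : z₀ = c * M := by
    conv_lhs => rw [← Complex.norm_mul_exp_arg_mul_I z₀, hz₀, mul_comm]
    rw [hc, Circle.coe_exp]
  have hrot : ∫⁻ z : ℂ, F ‖z‖ ‖z₀ - z‖ = ∫⁻ z : ℂ, F ‖z‖ ‖(M : ℂ) - z‖ := by
    rw [← (rotation c).measurePreserving.lintegral_comp (f := fun z => F ‖z‖ ‖z₀ - z‖)
      (by fun_prop)]
    refine lintegral_congr fun z => ?_
    have h1 : ‖rotation c z‖ = ‖z‖ := LinearIsometryEquiv.norm_map _ _
    have h2 : ‖z₀ - rotation c z‖ = ‖(M : ℂ) - z‖ := by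
      rw [rotation_apply, hcz, ← mul_sub, norm_mul, Circle.norm_coe, one_mul]
    rw [h1, h2]
  have hnorm (r θ : ℝ) : ‖(M : ℂ) - Complex.polarCoord.symm (r, θ)‖ =
      √(r ^ 2 + M ^ 2 - 2 * r * M * cos θ) := by
    rw [Complex.norm_eq_sqrt_sq_add_sq, Complex.polarCoord_symm_apply]
    congr 1
    simp [Complex.cos_ofReal_re, Complex.sin_ofReal_re]
    linear_combination r ^ 2 * sin_sq_add_cos_sq θ
  have hm : Measurable fun p : ℝ × ℝ =>
      ENNReal.ofReal p.1 * F |p.1| √(p.1 ^ 2 + M ^ 2 - 2 * p.1 * M * cos p.2) := by fun_prop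
  rw [hrot, ← Complex.lintegral_comp_polarCoord_symm, polarCoord_target]
  calc ∫⁻ p in Ioi 0 ×ˢ Ioo (-π) π, ENNReal.ofReal p.1 •
        F ‖Complex.polarCoord.symm p‖ ‖(M : ℂ) - Complex.polarCoord.symm p‖
      = ∫⁻ p in Ioi 0 ×ˢ Ioo (-π) π,
          ENNReal.ofReal p.1 * F |p.1| √(p.1 ^ 2 + M ^ 2 - 2 * p.1 * M * cos p.2) := by
        refine lintegral_congr fun p => ?_
        rw [hnorm p.1 p.2, Complex.norm_polarCoord_symm, smul_eq_mul]
    _ = ∫⁻ r in Ioi 0, ∫⁻ θ in Ioo (-π) π,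
          ENNReal.ofReal r * F |r| √(r ^ 2 + M ^ 2 - 2 * r * M * cos θ) := by
        rw [Measure.volume_eq_prod, ← Measure.prod_restrict, lintegral_prod _ hm.aemeasurable]
    _ ≤ _ := setLIntegral_mono' measurableSet_Ioi fun r hr => ?_
  have hr : 0 < r := hr
  rw [abs_of_pos hr]
  have hFr : Measurable fun θ => F r √(r ^ 2 + M ^ 2 - 2 * r * M * cos θ) := by fun_prop
  set A := ∫⁻ θ in Ioo 0 π, F r √(r ^ 2 + M ^ 2 - 2 * r * M * cos θ) with hA
  have hneg : ∫⁻ θ in Ioo (-π) 0, F r √(r ^ 2 + M ^ 2 - 2 * r * M * cos θ) = A := by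
    have h := (Measure.measurePreserving_neg (volume : Measure ℝ)).setLIntegral_comp_preimage
      (measurableSet_Ioo (a := 0) (b := π)) hFr
    rw [hA, ← h]
    simp
  have hsplit : ∫⁻ θ in Ioo (-π) π, F r √(r ^ 2 + M ^ 2 - 2 * r * M * cos θ) ≤ A + A := by
    have hsub : Ioo (-π) π ⊆ Icc 0 0 ∪ (Ioo (-π) 0 ∪ Ioo 0 π) := by
      intro θ hθ
      rcases lt_trichotomy θ 0 with h | h | h
      · exact Or.inr (Or.inl ⟨hθ.1, h⟩)
      · exact Or.inl ⟨h.ge, h.le⟩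
      · exact Or.inr (Or.inr ⟨h, hθ.2⟩)
    refine (lintegral_mono_set hsub).trans ((lintegral_union_le _ _ _).trans ?_)
    rw [setLIntegral_measure_zero _ _ (by simp), zero_add]
    refine (lintegral_union_le _ _ _).trans ?_
    rw [hneg]
  have hFr' : Measurable fun ρ => F r ρ := by fun_prop
  rw [lintegral_const_mul _ hFr]
  calc _ ≤ ENNReal.ofReal r * (2 * ∫⁻ ρ in Ioo |r - M| (r + M),
        ENNReal.ofReal (2 * ρ / (√((r + ρ) ^ 2 - M ^ 2) * √(M ^ 2 - (ρ - r) ^ 2))) * F r ρ) := by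
        gcongr
        refine hsplit.trans ?_
        rw [two_mul]
        gcongr <;> exact lintegral_angle_le hM hr _
    _ = _ := by
        rw [← mul_assoc, ← lintegral_const_mul _ (by fun_prop)]
        refine lintegral_congr fun ρ => ?_
        rw [← mul_assoc]
        congr 1
        rw [show (2 : ℝ≥0∞) = ENNReal.ofReal 2 by simp, ← ENNReal.ofReal_mul hr.le,
          ← ENNReal.ofReal_mul (by positivity), bipolarDensity]
        congr 1
        ring

/-- The weight `(1 + |x|)^{-p}`. -/
def decay (p x : ℝ) : ℝ := (1 + |x|) ^ (-p)

theorem decay_pos (p x : ℝ) : 0 < decay p x := by unfold decay; positivity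

theorem decay_nonneg (p x : ℝ) : 0 ≤ decay p x := (decay_pos p x).le

theorem decay_neg (p x : ℝ) : decay p (-x) = decay p x := by simp [decay]

theorem decay_add (p q x : ℝ) : decay (p + q) x = decay p x * decay q x := by
  unfold decay
  rw [neg_add, Real.rpow_add (by positivity)]

theorem decay_le_of_abs_le {p x y : ℝ} (hp : 0 ≤ p) (h : |x| ≤ |y|) : decay p y ≤ decay p x :=
  Real.rpow_le_rpow_of_nonpos (by positivity) (by linarith) (by linarith)

@[fun_prop]
theorem measurable_decay (p : ℝ) : Measurable (decay p) := by
  unfold decay; fun_prop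

theorem lintegral_decay_ne_top {p : ℝ} (hp : 1 < p) : ∫⁻ x, ENNReal.ofReal (decay p x) ≠ ∞ := by
  have h : Integrable (fun x : ℝ => (1 + ‖x‖) ^ (-p)) := integrable_one_add_norm (by simpa using hp)
  have := h.lintegral_lt_top
  simpa [decay] using this.ne

theorem lintegral_decay_sub (p t : ℝ) :
    ∫⁻ x, ENNReal.ofReal (decay p (x - t)) = ∫⁻ x, ENNReal.ofReal (decay p x) :=
  lintegral_sub_right_eq_self (fun x => ENNReal.ofReal (decay p x)) t

theorem lintegral_inv_sqrt_le (c : ℝ) {a : ℝ} (ha : 0 < a) :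
    ∫⁻ x in Ioo (c - a) (c + a), ENNReal.ofReal (√|x - c|)⁻¹ ≤ ENNReal.ofReal (4 * √a) := by
  have hpos : ∫⁻ x in Ioo 0 a, ENNReal.ofReal (√|x|)⁻¹ ≤ ENNReal.ofReal (2 * √a) := by
    have hint : IntegrableOn (fun x : ℝ => x ^ (-(1 / 2) : ℝ)) (Ioc 0 a) :=
      (intervalIntegrable_iff_integrableOn_Ioc_of_le ha.le).1
        (intervalIntegral.intervalIntegrable_rpow' (by norm_num))
    have hval : ∫ x in Ioc 0 a, x ^ (-(1 / 2) : ℝ) = 2 * √a := by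
      rw [← intervalIntegral.integral_of_le ha.le, integral_rpow (Or.inl (by norm_num)),
        Real.sqrt_eq_rpow]
      norm_num
      ring
    rw [← hval, ofReal_integral_eq_lintegral_ofReal hint
      ((ae_restrict_mem measurableSet_Ioc).mono fun x hx => Real.rpow_nonneg hx.1.le _)]
    refine (lintegral_mono_set Ioo_subset_Ioc_self).trans
      (setLIntegral_mono' measurableSet_Ioc fun x hx => ?_)
    rw [abs_of_pos hx.1, Real.sqrt_eq_rpow, Real.rpow_neg hx.1.le]
  have hneg : ∫⁻ x in Ioo (-a) 0, ENNReal.ofReal (√|x|)⁻¹ ≤ ENNReal.ofReal (2 * √a) := by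
    have h := (Measure.measurePreserving_neg (volume : Measure ℝ)).setLIntegral_comp_preimage
      (measurableSet_Ioo (a := 0) (b := a)) (f := fun x => ENNReal.ofReal (√|x|)⁻¹) (by fun_prop)
    refine le_trans (le_of_eq ?_) (h.trans_le hpos)
    simp
  have hshift : ∫⁻ x in Ioo (c - a) (c + a), ENNReal.ofReal (√|x - c|)⁻¹ =
      ∫⁻ x in Ioo (-a) a, ENNReal.ofReal (√|x|)⁻¹ := by
    have h := (measurePreserving_sub_right (volume : Measure ℝ) c).setLIntegral_comp_preimage
      (measurableSet_Ioo (a := -a) (b := a)) (f := fun x => ENNReal.ofReal (√|x|)⁻¹) (by fun_prop)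
    rw [← h]
    simp [sub_eq_add_neg, add_comm]
  have hsub : Ioo (-a) a ⊆ Icc 0 0 ∪ (Ioo (-a) 0 ∪ Ioo 0 a) := by
    intro x hx
    rcases lt_trichotomy x 0 with h | h | h
    · exact Or.inr (Or.inl ⟨hx.1, h⟩)
    · exact Or.inl ⟨h.ge, h.le⟩
    · exact Or.inr (Or.inr ⟨h, hx.2⟩)
  rw [hshift]
  refine (lintegral_mono_set hsub).trans ((lintegral_union_le _ _ _).trans ?_)
  rw [setLIntegral_measure_zero _ _ (by simp), zero_add]
  refine (lintegral_union_le _ _ _).trans ((add_le_add hneg hpos).trans_eq ?_)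
  rw [← ENNReal.ofReal_add (by positivity) (by positivity)]
  congr 1; ring

theorem decay_mul_inv_sqrt_le {p : ℝ} (hp : 1 < p) (t c x : ℝ) :
    decay (p - 1 / 2) (x - t) * (√|x - c|)⁻¹ ≤
      (Ioo (c - 1) (c + 1)).indicator (fun x => (√|x - c|)⁻¹) x +
        2 * (decay p (x - t) + decay p (x - c)) := by
  by_cases hx : x ∈ Ioo (c - 1) (c + 1)
  · rw [indicator_of_mem hx]
    have h1 : decay (p - 1 / 2) (x - t) ≤ 1 :=
      Real.rpow_le_one_of_one_le_of_nonpos (by linarith [abs_nonneg (x - t)]) (by linarith)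
    have := mul_le_of_le_one_left (inv_nonneg.2 (sqrt_nonneg |x - c|)) h1
    linarith [decay_nonneg p (x - t), decay_nonneg p (x - c)]
  · rw [indicator_of_notMem hx, zero_add]
    have hx1 : 1 ≤ |x - c| := by
      by_contra h
      have := abs_lt.1 (not_le.1 h)
      exact hx ⟨by linarith, by linarith⟩
    have h2 : (√|x - c|)⁻¹ ≤ 2 * decay (1 / 2) (x - c) := by
      rw [decay, Real.rpow_neg (by positivity), ← Real.sqrt_eq_rpow, ← div_eq_mul_inv,
        inv_eq_one_div, div_le_div_iff₀ (by positivity) (by positivity), one_mul]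
      rw [show (2 : ℝ) = √4 by rw [show (4 : ℝ) = 2 ^ 2 by norm_num]; simp,
        ← Real.sqrt_mul (by norm_num)]
      exact Real.sqrt_le_sqrt (by linarith)
    have h3 : decay (p - 1 / 2) (x - t) * decay (1 / 2) (x - c) ≤
        decay p (x - t) + decay p (x - c) := by
      have e (y : ℝ) : decay p y = decay (p - 1 / 2) y * decay (1 / 2) y := by
        rw [← decay_add]; congr 1; ring
      rcases le_total |x - t| |x - c| with h | h
      · refine le_add_of_le_of_nonneg ?_ (decay_nonneg _ _)
        rw [e (x - t)]
        exact mul_le_mul_of_nonneg_left (decay_le_of_abs_le (by norm_num) h) (decay_nonneg _ _)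
      · refine le_add_of_nonneg_of_le (decay_nonneg _ _) ?_
        rw [e (x - c)]
        exact mul_le_mul_of_nonneg_right (decay_le_of_abs_le (by linarith) h) (decay_nonneg _ _)
    calc _ ≤ decay (p - 1 / 2) (x - t) * (2 * decay (1 / 2) (x - c)) :=
          mul_le_mul_of_nonneg_left h2 (decay_nonneg _ _)
      _ ≤ _ := by linarith

theorem exists_lintegral_decay_mul_inv_sqrt_le {p : ℝ} (hp : 1 < p) :
    ∃ Z : ℝ≥0∞, Z ≠ ∞ ∧ ∀ t c : ℝ,
      ∫⁻ x, ENNReal.ofReal (decay (p - 1 / 2) (x - t) * (√|x - c|)⁻¹) ≤ Z := by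
  set I := ∫⁻ x, ENNReal.ofReal (decay p x) with hI
  refine ⟨ENNReal.ofReal (4 * √1) + 2 * (I + I), ?_, fun t c => ?_⟩
  · have := lintegral_decay_ne_top hp
    simp [ENNReal.mul_eq_top, hI, this]
  calc ∫⁻ x, ENNReal.ofReal (decay (p - 1 / 2) (x - t) * (√|x - c|)⁻¹)
      ≤ ∫⁻ x, ((Ioo (c - 1) (c + 1)).indicator (fun x => ENNReal.ofReal (√|x - c|)⁻¹) x +
          2 * (ENNReal.ofReal (decay p (x - t)) + ENNReal.ofReal (decay p (x - c)))) := by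
        refine lintegral_mono fun x => ?_
        refine (ENNReal.ofReal_le_ofReal (decay_mul_inv_sqrt_le hp t c x)).trans ?_
        refine ENNReal.ofReal_add_le.trans (add_le_add (le_of_eq ?_) (le_of_eq ?_))
        · by_cases hx : x ∈ Ioo (c - 1) (c + 1) <;> simp only [indicator, hx, if_true, if_false,
            ENNReal.ofReal_zero]
        · rw [ENNReal.ofReal_mul (by norm_num), ENNReal.ofReal_add (decay_nonneg _ _)
            (decay_nonneg _ _)]
          simp
    _ ≤ _ := by
        rw [lintegral_add_right _ (by fun_prop), lintegral_const_mul _ (by fun_prop),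
          lintegral_add_left (by fun_prop), lintegral_decay_sub, lintegral_decay_sub,
          lintegral_indicator measurableSet_Ioo]
        gcongr
        exact lintegral_inv_sqrt_le c one_pos

theorem lintegral_shear_le (σ : ℝ) {A : ℝ → ℝ≥0∞} {B F : ℝ → ℝ → ℝ≥0∞} (hA : Measurable A)
    (hB : Measurable (Function.uncurry B)) {R : Set ℝ} {S : ℝ → Set ℝ} (hR : MeasurableSet R)
    (hS : ∀ r, MeasurableSet (S r))
    (hle : ∀ r ∈ R, ∀ ρ ∈ S r, F r ρ ≤ A (ρ + σ * r) * B (ρ + σ * r) r) :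
    ∫⁻ r in R, ∫⁻ ρ in S r, F r ρ ≤ ∫⁻ u, A u * ∫⁻ r, B u r := by
  calc ∫⁻ r in R, ∫⁻ ρ in S r, F r ρ
      ≤ ∫⁻ r in R, ∫⁻ ρ, A (ρ + σ * r) * B (ρ + σ * r) r :=
        setLIntegral_mono' hR fun r hr =>
          (setLIntegral_mono' (hS r) (hle r hr)).trans (setLIntegral_le_lintegral _ _)
    _ ≤ ∫⁻ r, ∫⁻ ρ, A (ρ + σ * r) * B (ρ + σ * r) r := setLIntegral_le_lintegral _ _
    _ = ∫⁻ r, ∫⁻ u, A u * B u r := lintegral_congr fun r =>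
        lintegral_add_right_eq_self (fun u => A u * B u r) (σ * r)
    _ = ∫⁻ u, ∫⁻ r, A u * B u r := by
        refine lintegral_lintegral_swap (Measurable.aemeasurable ?_)
        exact (hA.comp measurable_snd).mul (hB.comp measurable_swap)
    _ = ∫⁻ u, A u * ∫⁻ r, B u r := lintegral_congr fun u =>
        lintegral_const_mul _ (hB.comp measurable_prodMk_left)

/-- The modulation weight for two waves of the same sign. -/
def sameSignWeight (p M t r ρ : ℝ) : ℝ :=
  decay (p - 1 / 2) (r + ρ - t) + √(r + ρ - M) * decay p (r + ρ - t)

/-- The modulation weight for two waves of opposite signs. -/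
def oppSignWeight (p M t r ρ : ℝ) : ℝ :=
  decay (p - 1 / 2) (ρ - r - t) + √(M - |ρ - r|) * decay p (ρ - r - t)

theorem mul_decay_le {p r : ℝ} (hr : 0 ≤ r) : r * decay (p + 1 / 2) r ≤ decay (p - 1 / 2) r := by
  have h : decay (p - 1 / 2) r = decay (p + 1 / 2) r * (1 + r) := by
    rw [show p - 1 / 2 = p + 1 / 2 + -1 by ring, decay_add]
    simp [decay, abs_of_nonneg hr]
  rw [h]
  nlinarith [decay_pos (p + 1 / 2) r]

theorem decay_mul_sqrt_le_one {p r : ℝ} (hp : 1 ≤ p) (hr : 0 ≤ r) :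
    decay (p - 1 / 2) r * √r ≤ 1 := by
  rw [decay, abs_of_nonneg hr, Real.rpow_neg (by positivity), inv_mul_le_one₀ (by positivity),
    Real.sqrt_eq_rpow]
  calc r ^ (1 / 2 : ℝ) ≤ (1 + r) ^ (1 / 2 : ℝ) :=
        Real.rpow_le_rpow hr (by linarith) (by norm_num)
    _ ≤ (1 + r) ^ (p - 1 / 2) := Real.rpow_le_rpow_of_exponent_le (by linarith) (by linarith)

theorem inv_sqrt_sq_sub_le {M v : ℝ} (hM : 0 < M) (hv : |v| < M) :
    (√(M ^ 2 - v ^ 2))⁻¹ ≤ (√M)⁻¹ * ((√|v - M|)⁻¹ + (√|v + M|)⁻¹) := by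
  have hv' := abs_lt.1 hv
  have h1 : 0 < M - v := by linarith
  have h2 : 0 < M + v := by linarith
  have e : M ^ 2 - v ^ 2 = (M - v) * (M + v) := by ring
  rw [abs_sub_comm, abs_of_pos h1, add_comm v M, abs_of_pos h2, e, Real.sqrt_mul h1.le, mul_inv]
  have a1 := inv_pos.2 (sqrt_pos.2 h1)
  have a2 := inv_pos.2 (sqrt_pos.2 h2)
  have a3 := inv_pos.2 (sqrt_pos.2 hM)
  rcases le_total 0 v with h | h
  · have : (√(M + v))⁻¹ ≤ (√M)⁻¹ :=
      inv_anti₀ (sqrt_pos.2 hM) (Real.sqrt_le_sqrt (by linarith))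
    nlinarith
  · have : (√(M - v))⁻¹ ≤ (√M)⁻¹ :=
      inv_anti₀ (sqrt_pos.2 hM) (Real.sqrt_le_sqrt (by linarith))
    nlinarith

theorem sqrt_sub_abs_mul_inv_le {M v : ℝ} (hM : 0 < M) (hv : |v| < M) :
    √(M - |v|) * (√(M ^ 2 - v ^ 2))⁻¹ ≤ (√M)⁻¹ := by
  have h1 : 0 < M - |v| := by linarith
  have e : M ^ 2 - v ^ 2 = (M - |v|) * (M + |v|) := by rw [← sq_abs v]; ring
  have h2 := abs_nonneg v
  rw [e, Real.sqrt_mul h1.le, mul_inv, ← mul_assoc, mul_inv_cancel₀ (sqrt_pos.2 h1).ne', one_mul]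
  exact inv_anti₀ (sqrt_pos.2 hM) (Real.sqrt_le_sqrt (by linarith))

theorem bipolarDensity_eq {M r ρ : ℝ} : bipolarDensity M r ρ =
    4 * r * ρ * ((√((r + ρ) ^ 2 - M ^ 2))⁻¹ * (√(M ^ 2 - (ρ - r) ^ 2))⁻¹) := by
  rw [bipolarDensity, div_eq_mul_inv, mul_inv]

theorem bipolarDensity_mul_oppSignWeight_le {p M t r ρ : ℝ} (hM : 0 < M) (hr : 0 < r)
    (hρ : ρ ∈ Ioo |r - M| (r + M)) :
    bipolarDensity M r ρ * (decay (p + 1 / 2) r * oppSignWeight p M t r ρ) ≤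
      4 * (r * decay (p + 1 / 2) r) * ρ * (√((r + ρ) ^ 2 - M ^ 2))⁻¹ * (√M)⁻¹ *
        (decay (p - 1 / 2) (ρ - r - t) * ((√|ρ - r - M|)⁻¹ + (√|ρ - r + M|)⁻¹) +
          decay p (ρ - r - t)) := by
  have hρ0 : 0 < ρ := (abs_nonneg _).trans_lt hρ.1
  have hv : |ρ - r| < M := by
    have := abs_lt.1 hρ.1
    exact abs_lt.2 ⟨by linarith, by linarith [hρ.2]⟩
  have key : (√(M ^ 2 - (ρ - r) ^ 2))⁻¹ * oppSignWeight p M t r ρ ≤ (√M)⁻¹ *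
        (decay (p - 1 / 2) (ρ - r - t) * ((√|ρ - r - M|)⁻¹ + (√|ρ - r + M|)⁻¹) +
          decay p (ρ - r - t)) := by
    have h1 := mul_le_mul_of_nonneg_left (inv_sqrt_sq_sub_le hM hv)
      (decay_nonneg (p - 1 / 2) (ρ - r - t))
    have h2 := mul_le_mul_of_nonneg_left (sqrt_sub_abs_mul_inv_le hM hv)
      (decay_nonneg p (ρ - r - t))
    unfold oppSignWeight
    linarith
  have hc : 0 ≤ 4 * (r * decay (p + 1 / 2) r) * ρ * (√((r + ρ) ^ 2 - M ^ 2))⁻¹ := by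
    have := decay_nonneg (p + 1 / 2) r
    positivity
  rw [bipolarDensity_eq, mul_assoc (_ * ρ * _)]
  refine le_trans (le_of_eq ?_) (mul_le_mul_of_nonneg_left key hc)
  ring

theorem inv_sqrt_abs_le_of_eq {x y : ℝ} (h : |x| = 2 * |y|) : (√|x|)⁻¹ ≤ (√|y|)⁻¹ := by
  rcases eq_or_lt_of_le (abs_nonneg y) with hy | hy
  · rw [h, ← hy]; simp
  · exact inv_anti₀ (sqrt_pos.2 hy) (Real.sqrt_le_sqrt (by linarith))

theorem bipolarDensity_mul_sameSignWeight_le {p M t r ρ : ℝ} (hp : 1 ≤ p) (hM : 0 < M)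
    (hr : 0 < r) (hρ : ρ ∈ Ioo |r - M| (r + M)) :
    bipolarDensity M r ρ * (decay (p + 1 / 2) r * sameSignWeight p M t r ρ) ≤
      (decay (p - 1 / 2) (r + ρ - t) * (√|r + ρ - M|)⁻¹ + decay p (r + ρ - t)) *
        (4 * (decay (p - 1 / 2) r + (√M)⁻¹) *
          ((√|r - (r + ρ - M) / 2|)⁻¹ + (√|r - (r + ρ + M) / 2|)⁻¹)) := by
  have hρ0 : 0 < ρ := (abs_nonneg _).trans_lt hρ.1
  have hb := abs_lt.1 hρ.1
  have hu : 0 < r + ρ - M := by linarith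
  have hv : |ρ - r| < M := abs_lt.2 ⟨by linarith, by linarith [hρ.2]⟩
  set S := (√|r - (r + ρ - M) / 2|)⁻¹ + (√|r - (r + ρ + M) / 2|)⁻¹ with hSdef
  have hS : 0 ≤ S := by positivity
  have hV : (√(M ^ 2 - (ρ - r) ^ 2))⁻¹ ≤ (√M)⁻¹ * S := by
    refine (inv_sqrt_sq_sub_le hM hv).trans (mul_le_mul_of_nonneg_left (add_le_add
      (inv_sqrt_abs_le_of_eq ?_) (inv_sqrt_abs_le_of_eq ?_)) (by positivity))
    · rw [show ρ - r - M = -2 * (r - (r + ρ - M) / 2) by ring, abs_mul]; norm_num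
    · rw [show ρ - r + M = -2 * (r - (r + ρ + M) / 2) by ring, abs_mul]; norm_num
  have hU : (√((r + ρ) ^ 2 - M ^ 2))⁻¹ = (√(r + ρ - M))⁻¹ * (√(r + ρ + M))⁻¹ := by
    rw [show (r + ρ) ^ 2 - M ^ 2 = (r + ρ - M) * (r + ρ + M) by ring, Real.sqrt_mul hu.le, mul_inv]
  have hW : (√(r + ρ - M))⁻¹ * sameSignWeight p M t r ρ =
      decay (p - 1 / 2) (r + ρ - t) * (√|r + ρ - M|)⁻¹ + decay p (r + ρ - t) := by
    have := (sqrt_pos.2 hu).ne'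
    rw [abs_of_pos hu, sameSignWeight]
    field_simp
  have hG : 0 ≤ decay (p - 1 / 2) (r + ρ - t) * (√|r + ρ - M|)⁻¹ + decay p (r + ρ - t) := by
    have := decay_nonneg (p - 1 / 2) (r + ρ - t)
    have := decay_nonneg p (r + ρ - t)
    positivity
  have hd := decay_nonneg (p - 1 / 2) r
  have hd' := decay_nonneg (p + 1 / 2) r
  have hsq : ρ * (√(r + ρ + M))⁻¹ ≤ √r + √M := by
    rw [← div_eq_mul_inv, div_le_iff₀ (sqrt_pos.2 (by linarith))]
    calc ρ = √ρ * √ρ := (Real.mul_self_sqrt hρ0.le).symm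
      _ ≤ (√r + √M) * √(r + ρ + M) := by
        refine mul_le_mul ?_ (Real.sqrt_le_sqrt (by linarith)) (by positivity) (by positivity)
        rw [Real.sqrt_le_left (by positivity)]
        nlinarith [Real.sq_sqrt hr.le, Real.sq_sqrt hM.le, hρ.2, sqrt_nonneg r, sqrt_nonneg M,
          mul_nonneg (sqrt_nonneg r) (sqrt_nonneg M)]
  have hMM : √M * (√M)⁻¹ = 1 := mul_inv_cancel₀ (sqrt_pos.2 hM).ne'
  have hc : (r * decay (p + 1 / 2) r) * ((√r + √M) * (√M)⁻¹) ≤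
      decay (p - 1 / 2) r + (√M)⁻¹ := by
    refine (mul_le_mul_of_nonneg_right (mul_decay_le hr.le) (by positivity)).trans ?_
    have := mul_le_mul_of_nonneg_right (decay_mul_sqrt_le_one hp hr.le)
      (inv_nonneg.2 (sqrt_nonneg M))
    rw [add_mul, hMM]
    linarith
  calc _ = ((√(r + ρ - M))⁻¹ * sameSignWeight p M t r ρ) *
        (4 * (r * decay (p + 1 / 2) r) * ((ρ * (√(r + ρ + M))⁻¹) *
          (√(M ^ 2 - (ρ - r) ^ 2))⁻¹)) := by
        rw [bipolarDensity_eq, hU]; ring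
    _ ≤ ((√(r + ρ - M))⁻¹ * sameSignWeight p M t r ρ) *
        (4 * (r * decay (p + 1 / 2) r) * ((√r + √M) * ((√M)⁻¹ * S))) := by
        rw [hW]
        gcongr
    _ = ((√(r + ρ - M))⁻¹ * sameSignWeight p M t r ρ) *
        (4 * ((r * decay (p + 1 / 2) r) * ((√r + √M) * (√M)⁻¹)) * S) := by ring
    _ ≤ _ := by
        rw [hW]
        gcongr

theorem exists_lintegral_sameSign_le {p : ℝ} (hp : 1 < p) :
    ∃ D : ℝ≥0∞, D ≠ ∞ ∧ ∀ M t : ℝ, 0 < M →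
      ∫⁻ r in Ioi 0, ∫⁻ ρ in Ioo |r - M| (r + M), ENNReal.ofReal (bipolarDensity M r ρ) *
        ENNReal.ofReal (decay (p + 1 / 2) r * sameSignWeight p M t r ρ) ≤ D := by
  obtain ⟨Z, hZ, hZle⟩ := exists_lintegral_decay_mul_inv_sqrt_le hp
  set I := ∫⁻ x, ENNReal.ofReal (decay p x) with hI
  have hI' : I ≠ ∞ := lintegral_decay_ne_top hp
  refine ⟨(Z + I) * (4 * (Z + Z) + 32), by finiteness, fun M t hM => ?_⟩
  set A : ℝ → ℝ≥0∞ := fun u =>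
    ENNReal.ofReal (decay (p - 1 / 2) (u - t) * (√|u - M|)⁻¹) + ENNReal.ofReal (decay p (u - t))
    with hA
  set N : ℝ → ℝ → ℝ≥0∞ := fun u r => ENNReal.ofReal (4 * (√M)⁻¹) *
    (ENNReal.ofReal (√|r - (u - M) / 2|)⁻¹ + ENNReal.ofReal (√|r - (u + M) / 2|)⁻¹) with hN
  set T : Set (ℝ × ℝ) := {x | (x.1 - M) / 2 < x.2 ∧ x.2 < (x.1 + M) / 2} with hT
  have hTm : MeasurableSet T :=
    (measurableSet_lt (f := fun x : ℝ × ℝ => (x.1 - M) / 2) (by fun_prop) measurable_snd).inter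
      (measurableSet_lt (g := fun x : ℝ × ℝ => (x.1 + M) / 2) measurable_snd (by fun_prop))
  set B : ℝ → ℝ → ℝ≥0∞ := fun u r =>
    4 * (ENNReal.ofReal (decay (p - 1 / 2) (r - 0) * (√|r - (u - M) / 2|)⁻¹) +
      ENNReal.ofReal (decay (p - 1 / 2) (r - 0) * (√|r - (u + M) / 2|)⁻¹)) +
    T.indicator (Function.uncurry N) (u, r) with hB
  have hNm : Measurable (Function.uncurry N) := by
    simp only [hN, Function.uncurry_def]; fun_prop
  have hBm : Measurable (Function.uncurry B) := by
    simp only [hB, Function.uncurry_def]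
    refine Measurable.add (by fun_prop) (hNm.indicator hTm)
  have hAI : ∫⁻ u, A u ≤ Z + I := by
    rw [hA, lintegral_add_left (by fun_prop), lintegral_decay_sub]
    exact add_le_add (hZle _ _) le_rfl
  have hBI (u : ℝ) : ∫⁻ r, B u r ≤ 4 * (Z + Z) + 32 := by
    have h1 : ∫⁻ r, T.indicator (Function.uncurry N) (u, r) ≤ 32 := by
      have e : (fun r => T.indicator (Function.uncurry N) (u, r)) =
          (Ioo ((u - M) / 2) ((u + M) / 2)).indicator (N u) := by
        ext r
        by_cases h : r ∈ Ioo ((u - M) / 2) ((u + M) / 2)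
        · rw [indicator_of_mem h, indicator_of_mem (show (u, r) ∈ T from h)]; rfl
        · rw [indicator_of_notMem h, indicator_of_notMem (show (u, r) ∉ T from h)]
      rw [e, lintegral_indicator measurableSet_Ioo, hN,
        lintegral_const_mul _ (by fun_prop), lintegral_add_left (by fun_prop)]
      have s1 : ∫⁻ r in Ioo ((u - M) / 2) ((u + M) / 2), ENNReal.ofReal (√|r - (u - M) / 2|)⁻¹ ≤
          ENNReal.ofReal (4 * √M) :=
        (lintegral_mono_set (Ioo_subset_Ioo (by linarith) (by linarith))).trans
          (lintegral_inv_sqrt_le ((u - M) / 2) hM)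
      have s2 : ∫⁻ r in Ioo ((u - M) / 2) ((u + M) / 2), ENNReal.ofReal (√|r - (u + M) / 2|)⁻¹ ≤
          ENNReal.ofReal (4 * √M) :=
        (lintegral_mono_set (Ioo_subset_Ioo (by linarith) (by linarith))).trans
          (lintegral_inv_sqrt_le ((u + M) / 2) hM)
      refine (mul_le_mul_right (add_le_add s1 s2) _).trans_eq ?_
      rw [← ENNReal.ofReal_add (by positivity) (by positivity), ← ENNReal.ofReal_mul (by positivity)]
      have := (sqrt_pos.2 hM).ne'
      rw [show 4 * (√M)⁻¹ * (4 * √M + 4 * √M) = 32 by field_simp; norm_num]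
      simp
    rw [hB, lintegral_add_left (by fun_prop), lintegral_const_mul _ (by fun_prop),
      lintegral_add_left (by fun_prop)]
    exact add_le_add (mul_le_mul_right (add_le_add (hZle _ _) (hZle _ _)) _) h1
  calc _ ≤ ∫⁻ u, A u * ∫⁻ r, B u r := by
        refine lintegral_shear_le 1 (by fun_prop) hBm measurableSet_Ioi
          (fun _ => measurableSet_Ioo) fun r hr ρ hρ => ?_
        have hr : 0 < r := hr
        have hb := abs_lt.1 hρ.1
        have hT' : (r + ρ, r) ∈ T :=
          ⟨by dsimp only; linarith [hρ.2], by dsimp only; linarith⟩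
        rw [← ENNReal.ofReal_mul' (by
          have := decay_nonneg (p + 1 / 2) r
          have := decay_nonneg (p - 1 / 2) (r + ρ - t)
          have := decay_nonneg p (r + ρ - t)
          unfold sameSignWeight; positivity)]
        refine (ENNReal.ofReal_le_ofReal
          (bipolarDensity_mul_sameSignWeight_le hp.le hM hr hρ)).trans_eq ?_
        have d1 := decay_nonneg (p - 1 / 2) r
        have d2 := decay_nonneg p (r + ρ - t)
        have d3 := decay_nonneg (p - 1 / 2) (r + ρ - t)
        rw [ENNReal.ofReal_mul (by positivity), ENNReal.ofReal_add (by positivity) d2]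
        simp only [hB, hA, one_mul, add_comm ρ r]
        rw [indicator_of_mem hT']
        simp only [Function.uncurry_apply_pair, hN, sub_zero]
        congr 1
        rw [← ENNReal.ofReal_add (by positivity) (by positivity),
          ← ENNReal.ofReal_add (by positivity) (by positivity),
          ← ENNReal.ofReal_mul (by positivity), show (4 : ℝ≥0∞) = ENNReal.ofReal 4 by simp,
          ← ENNReal.ofReal_mul (by positivity), ← ENNReal.ofReal_add (by positivity) (by positivity)]
        congr 1
        ring
    _ ≤ ∫⁻ u, A u * (4 * (Z + Z) + 32) := lintegral_mono fun u => mul_le_mul_right (hBI u) _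
    _ ≤ _ := by
        rw [lintegral_mul_const _ (by fun_prop)]
        exact mul_le_mul_left hAI _

theorem lintegral_oppSign_factor_le {p M t : ℝ} {Z I : ℝ≥0∞}
    (hZ : ∀ t c : ℝ, ∫⁻ x, ENNReal.ofReal (decay (p - 1 / 2) (x - t) * (√|x - c|)⁻¹) ≤ Z)
    (hI : I = ∫⁻ x, ENNReal.ofReal (decay p x)) :
    ∫⁻ v, ENNReal.ofReal (decay (p - 1 / 2) (v - t) * ((√|v - M|)⁻¹ + (√|v + M|)⁻¹) +
      decay p (v - t)) ≤ Z + Z + I := by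
  calc _ ≤ ∫⁻ v, (ENNReal.ofReal (decay (p - 1 / 2) (v - t) * (√|v - M|)⁻¹) +
        ENNReal.ofReal (decay (p - 1 / 2) (v - t) * (√|v - -M|)⁻¹) +
        ENNReal.ofReal (decay p (v - t))) := by
        refine lintegral_mono fun v => ?_
        rw [mul_add, sub_neg_eq_add]
        exact ENNReal.ofReal_add_le.trans (add_le_add_left ENNReal.ofReal_add_le _)
    _ ≤ _ := by
        rw [lintegral_add_left (by fun_prop), lintegral_add_left (by fun_prop),
          lintegral_decay_sub, ← hI]
        exact add_le_add (add_le_add (hZ _ _) (hZ _ _)) le_rfl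

theorem oppSign_factor_nonneg (p M t v : ℝ) :
    0 ≤ decay (p - 1 / 2) (v - t) * ((√|v - M|)⁻¹ + (√|v + M|)⁻¹) + decay p (v - t) := by
  have := decay_nonneg (p - 1 / 2) (v - t)
  have := decay_nonneg p (v - t)
  positivity

theorem oppSignWeight_nonneg (p M t r ρ : ℝ) : 0 ≤ oppSignWeight p M t r ρ := by
  have := decay_nonneg (p - 1 / 2) (ρ - r - t)
  have := decay_nonneg p (ρ - r - t)
  unfold oppSignWeight; positivity

theorem exists_lintegral_oppSign_near_le {p : ℝ} (hp : 1 < p) :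
    ∃ D : ℝ≥0∞, D ≠ ∞ ∧ ∀ M t : ℝ, 0 < M →
      ∫⁻ r in Ioi 0, ∫⁻ ρ in Ioo |r - M| (r + M), ENNReal.ofReal (bipolarDensity M r ρ) *
        (if r + ρ ≤ 2 * M then
          ENNReal.ofReal (decay (p + 1 / 2) r * oppSignWeight p M t r ρ) else 0) ≤ D := by
  obtain ⟨Z, hZ, hZle⟩ := exists_lintegral_decay_mul_inv_sqrt_le hp
  set I := ∫⁻ x, ENNReal.ofReal (decay p x) with hI
  have hI' : I ≠ ∞ := lintegral_decay_ne_top hp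
  refine ⟨(Z + Z + I) * (8 * Z), by finiteness, fun M t hM => ?_⟩
  set A : ℝ → ℝ≥0∞ := fun v =>
    ENNReal.ofReal (decay (p - 1 / 2) (v - t) * ((√|v - M|)⁻¹ + (√|v + M|)⁻¹) + decay p (v - t))
    with hA
  set B : ℝ → ℝ → ℝ≥0∞ := fun v r =>
    8 * ENNReal.ofReal (decay (p - 1 / 2) (r - 0) * (√|r - (M - v) / 2|)⁻¹) with hB
  have hBI (v : ℝ) : ∫⁻ r, B v r ≤ 8 * Z := by
    rw [hB, lintegral_const_mul _ (by fun_prop)]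
    exact mul_le_mul_right (hZle _ _) _
  calc _ ≤ ∫⁻ v, A v * ∫⁻ r, B v r := by
        refine lintegral_shear_le (-1) (by fun_prop)
          (by simp only [hB, Function.uncurry_def]; fun_prop) measurableSet_Ioi
          (fun _ => measurableSet_Ioo) fun r hr ρ hρ => ?_
        have hr : 0 < r := hr
        have hb := abs_lt.1 hρ.1
        have hρ0 : 0 < ρ := (abs_nonneg _).trans_lt hρ.1
        split_ifs with hc
        swap
        · simp
        rw [← ENNReal.ofReal_mul' (mul_nonneg (decay_nonneg _ _) (oppSignWeight_nonneg _ _ _ _ _))]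
        refine (ENNReal.ofReal_le_ofReal (?_ : _ ≤
          (decay (p - 1 / 2) (ρ - r - t) * ((√|ρ - r - M|)⁻¹ + (√|ρ - r + M|)⁻¹) +
            decay p (ρ - r - t)) *
          (8 * (decay (p - 1 / 2) (r - 0) * (√|r - (M - (ρ - r)) / 2|)⁻¹)))).trans_eq ?_
        · refine (bipolarDensity_mul_oppSignWeight_le hM hr hρ).trans ?_
          rw [mul_comm]
          refine mul_le_mul_of_nonneg_left ?_ (oppSign_factor_nonneg _ _ _ _)
          have hu : 0 < r + ρ - M := by linarith
          have h1 : (√((r + ρ) ^ 2 - M ^ 2))⁻¹ ≤ (√|r - (M - (ρ - r)) / 2|)⁻¹ * (√M)⁻¹ := by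
            rw [show r - (M - (ρ - r)) / 2 = (r + ρ - M) / 2 by ring,
              abs_of_pos (by linarith), ← mul_inv, ← Real.sqrt_mul (by linarith)]
            refine inv_anti₀ (sqrt_pos.2 (by positivity)) (Real.sqrt_le_sqrt ?_)
            nlinarith
          have h2 := mul_decay_le (p := p) hr.le
          have h0 := decay_nonneg (p + 1 / 2) r
          have h0' := decay_nonneg (p - 1 / 2) r
          have h3 : (√M)⁻¹ * (√M)⁻¹ = M⁻¹ := by rw [← mul_inv, Real.mul_self_sqrt hM.le]
          have h4 : ρ * M⁻¹ ≤ 2 := by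
            rw [← div_eq_mul_inv, div_le_iff₀ hM]; linarith
          rw [sub_zero]
          calc _ ≤ 4 * decay (p - 1 / 2) r * ρ *
                ((√|r - (M - (ρ - r)) / 2|)⁻¹ * (√M)⁻¹) * (√M)⁻¹ := by gcongr
            _ = 4 * decay (p - 1 / 2) r * (√|r - (M - (ρ - r)) / 2|)⁻¹ *
                (ρ * ((√M)⁻¹ * (√M)⁻¹)) := by ring
            _ ≤ 4 * decay (p - 1 / 2) r * (√|r - (M - (ρ - r)) / 2|)⁻¹ * 2 := by
                rw [h3]; gcongr
            _ = _ := by ring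
        · rw [ENNReal.ofReal_mul (oppSign_factor_nonneg _ _ _ _), ENNReal.ofReal_mul (by norm_num)]
          simp only [hA, hB, neg_mul, one_mul, ← sub_eq_add_neg]
          simp
    _ ≤ ∫⁻ v, A v * (8 * Z) := lintegral_mono fun v => mul_le_mul_right (hBI v) _
    _ ≤ _ := by
        rw [lintegral_mul_const _ (by fun_prop)]
        exact mul_le_mul_left (lintegral_oppSign_factor_le hZle hI) _

theorem exists_lintegral_oppSign_far_le {p : ℝ} (hp : 1 < p) (hp2 : p ≤ 2) :
    ∃ D : ℝ≥0∞, D ≠ ∞ ∧ ∀ M t a L : ℝ, 0 < M → 0 ≤ L →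
      ∫⁻ r in Ioi 0, ∫⁻ ρ in Ioo |r - M| (r + M), ENNReal.ofReal (bipolarDensity M r ρ) *
        (if 2 * M < r + ρ ∧ r ∈ Icc a (a + L) then
          ENNReal.ofReal (decay (p + 1 / 2) r * oppSignWeight p M t r ρ) else 0) ≤
        D * ENNReal.ofReal (L * ((√M)⁻¹ * decay (p - 1 / 2) M)) := by
  obtain ⟨Z, hZ, hZle⟩ := exists_lintegral_decay_mul_inv_sqrt_le hp
  set I := ∫⁻ x, ENNReal.ofReal (decay p x) with hI
  have hI' : I ≠ ∞ := lintegral_decay_ne_top hp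
  refine ⟨(Z + Z + I) * 32, by finiteness, fun M t a L hM hL => ?_⟩
  set A : ℝ → ℝ≥0∞ := fun v =>
    ENNReal.ofReal (decay (p - 1 / 2) (v - t) * ((√|v - M|)⁻¹ + (√|v + M|)⁻¹) + decay p (v - t))
    with hA
  set B : ℝ → ℝ → ℝ≥0∞ := fun _ => (Icc a (a + L)).indicator fun _ =>
    32 * ENNReal.ofReal ((√M)⁻¹ * decay (p - 1 / 2) M) with hB
  have hBI (v : ℝ) : ∫⁻ r, B v r ≤ 32 * ENNReal.ofReal (L * ((√M)⁻¹ * decay (p - 1 / 2) M)) := by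
    rw [hB, lintegral_indicator measurableSet_Icc, setLIntegral_const, Real.volume_Icc,
      ENNReal.ofReal_mul hL, mul_assoc, mul_comm (ENNReal.ofReal L)]
    simp
  calc _ ≤ ∫⁻ v, A v * ∫⁻ r, B v r := by
        refine lintegral_shear_le (-1) (B := B) (by fun_prop)
          ((measurable_const.indicator measurableSet_Icc).comp measurable_snd) measurableSet_Ioi
          (fun _ => measurableSet_Ioo) fun r hr ρ hρ => ?_
        have hr : 0 < r := hr
        have hb := abs_lt.1 hρ.1
        have hρ0 : 0 < ρ := (abs_nonneg _).trans_lt hρ.1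
        split_ifs with hc
        swap
        · simp
        rw [← ENNReal.ofReal_mul' (mul_nonneg (decay_nonneg _ _) (oppSignWeight_nonneg _ _ _ _ _))]
        refine (ENNReal.ofReal_le_ofReal (?_ : _ ≤
          (decay (p - 1 / 2) (ρ - r - t) * ((√|ρ - r - M|)⁻¹ + (√|ρ - r + M|)⁻¹) +
            decay p (ρ - r - t)) *
          (32 * ((√M)⁻¹ * decay (p - 1 / 2) M)))).trans_eq ?_
        · refine (bipolarDensity_mul_oppSignWeight_le hM hr hρ).trans ?_
          rw [mul_comm]
          refine mul_le_mul_of_nonneg_left ?_ (oppSign_factor_nonneg _ _ _ _)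
          have hu : 0 < r + ρ - M := by linarith
          have h1 : ρ * (√((r + ρ) ^ 2 - M ^ 2))⁻¹ ≤ 2 := by
            have h : (r + ρ) / 2 ≤ √((r + ρ) ^ 2 - M ^ 2) := by
              refine Real.le_sqrt_of_sq_le ?_
              nlinarith [hc.1]
            rw [← div_eq_mul_inv, div_le_iff₀ (by linarith)]
            linarith
          have h2 := mul_decay_le (p := p) hr.le
          have h0 := decay_nonneg (p + 1 / 2) r
          have h0' := decay_nonneg (p - 1 / 2) r
          have h5 : decay (p - 1 / 2) r ≤ 4 * decay (p - 1 / 2) M := by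
            have hq : 0 ≤ p - 1 / 2 := by linarith
            unfold decay
            rw [abs_of_pos hr, abs_of_pos hM]
            calc (1 + r) ^ (-(p - 1 / 2)) ≤ ((1 + M) / 2) ^ (-(p - 1 / 2)) :=
                  Real.rpow_le_rpow_of_nonpos (by positivity) (by linarith [hρ.2, hc.1])
                    (by linarith)
              _ = 2 ^ (p - 1 / 2) * (1 + M) ^ (-(p - 1 / 2)) := by
                  rw [Real.div_rpow (by positivity) (by norm_num), Real.rpow_neg zero_le_two,
                    div_inv_eq_mul, mul_comm]
              _ ≤ 2 ^ (2 : ℝ) * (1 + M) ^ (-(p - 1 / 2)) := by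
                  gcongr
                  · norm_num
                  · linarith
              _ = _ := by norm_num
          calc _ = 4 * (r * decay (p + 1 / 2) r) * (ρ * (√((r + ρ) ^ 2 - M ^ 2))⁻¹) * (√M)⁻¹ := by
                ring
            _ ≤ 4 * decay (p - 1 / 2) r * 2 * (√M)⁻¹ := by gcongr
            _ ≤ 4 * (4 * decay (p - 1 / 2) M) * 2 * (√M)⁻¹ := by gcongr
            _ = _ := by ring
        · rw [ENNReal.ofReal_mul (oppSign_factor_nonneg _ _ _ _), ENNReal.ofReal_mul (by norm_num)]
          simp only [hA, hB, neg_mul, one_mul, ← sub_eq_add_neg]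
          rw [indicator_of_mem hc.2]
          simp
    _ ≤ ∫⁻ v, A v * (32 * ENNReal.ofReal (L * ((√M)⁻¹ * decay (p - 1 / 2) M))) :=
        lintegral_mono fun v => mul_le_mul_right (hBI v) _
    _ ≤ _ := by
        rw [lintegral_mul_const _ (by fun_prop), mul_assoc]
        exact mul_le_mul_left (lintegral_oppSign_factor_le hZle hI) _

/-- The spatial part of a space-time frequency, as a complex number. -/
def spatial (ζ : SpaceTime) : ℂ := ⟨ζ 1, ζ 2⟩

theorem norm_spatial (ζ : SpaceTime) : ‖spatial ζ‖ = spFreq ζ := by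
  rw [Complex.norm_def, Complex.normSq_mk, spFreq, sq, sq, spatial]

theorem spatial_sub (ζ η : SpaceTime) : spatial (ζ - η) = spatial ζ - spatial η := by
  apply Complex.ext <;> simp [spatial]

theorem spFreq_sub (ζ η : SpaceTime) : spFreq (ζ - η) = ‖spatial ζ - spatial η‖ := by
  rw [← spatial_sub, norm_spatial]

theorem spFreq_nonneg (ζ : SpaceTime) : 0 ≤ spFreq ζ := sqrt_nonneg _

theorem abs_spFreq_sub_sub_le (ζ η : SpaceTime) : |spFreq (ζ - η) - spFreq η| ≤ spFreq ζ := by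
  rw [spFreq_sub, ← norm_spatial, ← norm_spatial, ← norm_neg (spatial η)]
  refine (abs_norm_sub_norm_le _ _).trans_eq ?_
  simp

theorem spFreq_le_add (ζ η : SpaceTime) : spFreq ζ ≤ spFreq η + spFreq (ζ - η) := by
  rw [spFreq_sub, ← norm_spatial, ← norm_spatial]
  calc _ = ‖spatial η + (spatial ζ - spatial η)‖ := by congr 1; ring
    _ ≤ _ := norm_add_le _ _

@[fun_prop]
theorem measurable_spFreq : Measurable spFreq := by
  unfold spFreq; fun_prop

theorem measurePreserving_time_spatial :
    MeasurePreserving (fun ζ : SpaceTime => (ζ 0, spatial ζ)) := by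
  have h1 := PiLp.volume_preserving_ofLp (Fin 3)
  have h2 := volume_preserving_piFinSuccAbove (fun _ : Fin 3 => ℝ) 0
  have h3 := (MeasurePreserving.id (volume : Measure ℝ)).prod
    (Complex.volume_preserving_equiv_pi.symm)
  have e : (fun ζ : SpaceTime => (ζ 0, spatial ζ)) = Prod.map id Complex.measurableEquivPi.symm ∘
      MeasurableEquiv.piFinSuccAbove (fun _ => ℝ) 0 ∘ WithLp.ofLp := by
    funext ζ
    refine Prod.ext rfl (Complex.ext ?_ ?_) <;>
      simp [spatial, Complex.measurableEquivPi_symm_apply, MeasurableEquiv.piFinSuccAbove,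
        Fin.insertNthEquiv] <;>
      rfl
  rw [e]
  exact h3.comp (h2.comp h1)

theorem lintegral_spaceTime (f : ℝ → ℂ → ℝ≥0∞) (hf : Measurable (Function.uncurry f)) :
    ∫⁻ ζ : SpaceTime, f (ζ 0) (spatial ζ) = ∫⁻ z, ∫⁻ τ, f τ z := by
  have h := measurePreserving_time_spatial.lintegral_comp hf
  simp only [Function.uncurry_apply_pair] at h
  rw [h, Measure.volume_eq_prod, lintegral_prod_symm _ hf.aemeasurable]
  rfl

theorem ae_spFreq_pos : ∀ᵐ ζ : SpaceTime, 0 < spFreq ζ := by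
  have h : ∀ᵐ z : ℂ, z ≠ 0 := by simp [ae_iff]
  have h' := ((Measure.quasiMeasurePreserving_snd (μ := (volume : Measure ℝ))).comp
    measurePreserving_time_spatial.quasiMeasurePreserving).ae h
  filter_upwards [h'] with ζ hζ
  rw [← norm_spatial]
  exact norm_pos_iff.2 hζ

theorem lintegral_modulation_le {p : ℝ} {ξ : SpaceTime} (hξ : 0 < spFreq ξ) (σ σ' : ℝ)
    {F : ℝ → ℝ → ℝ≥0∞} (hF : Measurable (Function.uncurry F)) :
    ∫⁻ η, F (spFreq η) (spFreq (ξ - η)) *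
      (ENNReal.ofReal (decay p ((ξ - η) 0 - σ * spFreq (ξ - η))) +
        ENNReal.ofReal (decay p (η 0 - σ' * spFreq η))) ≤
      (2 * ∫⁻ x, ENNReal.ofReal (decay p x)) *
        ∫⁻ r in Ioi 0, ∫⁻ ρ in Ioo |r - spFreq ξ| (r + spFreq ξ),
          ENNReal.ofReal (bipolarDensity (spFreq ξ) r ρ) * F r ρ := by
  have hFm : Measurable fun x : ℂ => F ‖x‖ ‖spatial ξ - x‖ :=
    hF.comp (f := fun x : ℂ => (‖x‖, ‖spatial ξ - x‖)) (by fun_prop)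
  have hFm' : Measurable fun x : ℝ × ℂ => F ‖x.2‖ ‖spatial ξ - x.2‖ := hFm.comp measurable_snd
  calc _ = ∫⁻ η : SpaceTime, (fun τ z => F ‖z‖ ‖spatial ξ - z‖ *
        (ENNReal.ofReal (decay p (τ - (ξ 0 - σ * ‖spatial ξ - z‖))) +
          ENNReal.ofReal (decay p (τ - σ' * ‖z‖)))) (η 0) (spatial η) := by
        refine lintegral_congr fun η => ?_
        rw [spFreq_sub, ← norm_spatial, ← decay_neg p ((ξ - η) 0 - _)]
        simp only [PiLp.sub_apply]
        ring_nf
    _ = ∫⁻ z, F ‖z‖ ‖spatial ξ - z‖ * (2 * ∫⁻ x, ENNReal.ofReal (decay p x)) := by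
        rw [lintegral_spaceTime (fun τ z => F ‖z‖ ‖spatial ξ - z‖ *
          (ENNReal.ofReal (decay p (τ - (ξ 0 - σ * ‖spatial ξ - z‖))) +
            ENNReal.ofReal (decay p (τ - σ' * ‖z‖)))) (by
          simp only [Function.uncurry_def]
          exact hFm'.mul (by fun_prop))]
        refine lintegral_congr fun z => ?_
        rw [lintegral_const_mul _ (by fun_prop), lintegral_add_left (by fun_prop),
          lintegral_decay_sub, lintegral_decay_sub, two_mul]
    _ ≤ _ := by
        rw [lintegral_mul_const _ hFm, mul_comm]
        exact mul_le_mul_right (lintegral_bipolar_le hξ (norm_spatial ξ) hF) _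

theorem sqrt_mul_decay_mul_decay_le {p : ℝ} (hp : 1 ≤ p) (hp2 : p ≤ 2) {W b y₁ y₂ : ℝ}
    (hb : 0 ≤ b) (hW : W ≤ 1 + |y₁| + |y₂| + b) :
    √W * decay p y₁ * decay p y₂ ≤ 8 * (decay (p - 1 / 2) (y₁ + y₂) + √b * decay p (y₁ + y₂)) *
      (decay p y₁ + decay p y₂) := by
  wlog h : |y₂| ≤ |y₁| generalizing y₁ y₂
  · have := this (y₁ := y₂) (y₂ := y₁) (by linarith) (le_of_not_ge h)
    rw [add_comm y₂, add_comm (decay p y₂)] at this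
    linarith
  set x := y₁ + y₂
  have hx : |x| ≤ 2 * |y₁| := (abs_add_le _ _).trans (by linarith)
  have hq {q : ℝ} (h0 : 0 ≤ q) (h2 : q ≤ 2) : decay q y₁ ≤ 4 * decay q x := by
    unfold decay
    calc (1 + |y₁|) ^ (-q) ≤ ((1 + |x|) / 2) ^ (-q) :=
          Real.rpow_le_rpow_of_nonpos (by positivity) (by linarith) (by linarith)
      _ = 2 ^ q * (1 + |x|) ^ (-q) := by
          rw [Real.div_rpow (by positivity) (by norm_num), Real.rpow_neg zero_le_two,
            div_inv_eq_mul, mul_comm]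
      _ ≤ 2 ^ (2 : ℝ) * (1 + |x|) ^ (-q) := by
          gcongr
          norm_num
      _ = _ := by norm_num
  have hs : √W ≤ 2 * √(1 + |y₁|) + √b := by
    rw [Real.sqrt_le_left (by positivity)]
    nlinarith [Real.sq_sqrt hb, Real.sq_sqrt (show 0 ≤ 1 + |y₁| by positivity), sqrt_nonneg b,
      sqrt_nonneg (1 + |y₁|), mul_nonneg (sqrt_nonneg b) (sqrt_nonneg (1 + |y₁|)), abs_nonneg y₁]
  have hd : √(1 + |y₁|) * decay p y₁ = decay (p - 1 / 2) y₁ := by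
    rw [show p - 1 / 2 = -(1 / 2) + p by ring, decay_add, decay, decay, neg_neg,
      Real.sqrt_eq_rpow]
  have h1 := decay_nonneg p y₁
  have h2 := decay_nonneg p y₂
  have h3 := hq (q := p) (by linarith) hp2
  have h4 := hq (q := p - 1 / 2) (by linarith) (by linarith)
  have h5 := decay_nonneg p x
  have h6 := decay_nonneg (p - 1 / 2) x
  have h7 := sqrt_nonneg b
  calc _ ≤ (2 * √(1 + |y₁|) + √b) * decay p y₁ * decay p y₂ := by gcongr
    _ = (2 * decay (p - 1 / 2) y₁ + √b * decay p y₁) * decay p y₂ := by rw [← hd]; ring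
    _ ≤ (2 * (4 * decay (p - 1 / 2) x) + √b * (4 * decay p x)) * decay p y₂ := by gcongr
    _ ≤ (8 * (decay (p - 1 / 2) x + √b * decay p x)) * decay p y₂ := by
        gcongr
        nlinarith
    _ ≤ _ := by
        gcongr
        linarith

theorem abs_abs_sub_le {τ₁ τ₂ ρ₁ ρ₂ M b : ℝ} (hb : |(|ρ₁ + ρ₂| - M)| ≤ b) :
    |(|τ₁ + τ₂| - M)| ≤ |τ₁ - ρ₁| + |τ₂ - ρ₂| + b := by
  have h1 : |(|τ₁ + τ₂| - |ρ₁ + ρ₂|)| ≤ |τ₁ - ρ₁| + |τ₂ - ρ₂| := by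
    refine (abs_abs_sub_abs_le _ _).trans ?_
    rw [show τ₁ + τ₂ - (ρ₁ + ρ₂) = (τ₁ - ρ₁) + (τ₂ - ρ₂) by ring]
    exact abs_add_le _ _
  calc _ ≤ |(|τ₁ + τ₂| - |ρ₁ + ρ₂|)| + |(|ρ₁ + ρ₂| - M)| := abs_sub_le _ _ _
    _ ≤ _ := add_le_add h1 hb

theorem summable_dyadic {p : ℝ} (hp : 1 < p) :
    Summable fun j : ℤ => (√((2 : ℝ) ^ j) * decay (p - 1 / 2) ((2 : ℝ) ^ j)) ^ (1 / 2 : ℝ) := by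
  have hnn (m : ℝ) : 0 ≤ √m * decay (p - 1 / 2) m :=
    mul_nonneg (sqrt_nonneg _) (decay_nonneg _ _)
  refine Summable.of_nat_of_neg ?_ ?_
  · refine Summable.of_nonneg_of_le (fun n => Real.rpow_nonneg (hnn _) _) (fun n => ?_)
      (summable_geometric_of_lt_one (r := (2 : ℝ) ^ (-((p - 1) / 2))) (by positivity)
        (Real.rpow_lt_one_of_one_lt_of_neg one_lt_two (by linarith)))
    rw [Real.rpow_pow_comm zero_le_two, zpow_natCast]
    have hm : (0 : ℝ) < 2 ^ n := by positivity
    generalize (2 : ℝ) ^ n = m at hm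
    have h : √m * decay (p - 1 / 2) m ≤ m ^ (-(p - 1)) := by
      calc √m * decay (p - 1 / 2) m ≤ m ^ (1 / 2 : ℝ) * m ^ (-(p - 1 / 2)) := by
            rw [Real.sqrt_eq_rpow, decay, abs_of_pos hm]
            exact mul_le_mul_of_nonneg_left
              (Real.rpow_le_rpow_of_nonpos hm (by linarith) (by linarith)) (by positivity)
        _ = _ := by rw [← Real.rpow_add hm]; congr 1; ring
    calc _ ≤ (m ^ (-(p - 1))) ^ (1 / 2 : ℝ) := Real.rpow_le_rpow (hnn m) h (by norm_num)
      _ = _ := by rw [← Real.rpow_mul hm.le]; congr 1; ring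
  · refine Summable.of_nonneg_of_le (fun n => Real.rpow_nonneg (hnn _) _) (fun n => ?_)
      (summable_geometric_of_lt_one (r := (1 / 2 : ℝ) ^ (1 / 4 : ℝ)) (by positivity)
        (Real.rpow_lt_one (by norm_num) (by norm_num) (by norm_num)))
    rw [Real.rpow_pow_comm (by norm_num), zpow_neg, zpow_natCast, ← inv_pow, ← one_div]
    have hm : (0 : ℝ) < (1 / 2) ^ n := by positivity
    generalize (1 / 2 : ℝ) ^ n = m at hm
    have h : √m * decay (p - 1 / 2) m ≤ √m :=
      mul_le_of_le_one_right (sqrt_nonneg _)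
        (Real.rpow_le_one_of_one_le_of_nonpos (by linarith [abs_nonneg m]) (by linarith))
    calc _ ≤ (√m) ^ (1 / 2 : ℝ) := Real.rpow_le_rpow (hnn m) h (by norm_num)
      _ = _ := by rw [Real.sqrt_eq_rpow, ← Real.rpow_mul hm.le]; norm_num

/-- The weight localizing the two waves near the cones `τ = ± |ξ|`. -/
def modulationWeight (p σ σ' : ℝ) (ξ η : SpaceTime) : ℝ≥0∞ :=
  ENNReal.ofReal (decay p ((ξ - η) 0 - σ * spFreq (ξ - η))) +
    ENNReal.ofReal (decay p (η 0 - σ' * spFreq η))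

def sameSignKernel (p σ : ℝ) (ξ η : SpaceTime) : ℝ≥0∞ :=
  ENNReal.ofReal (decay (p + 1 / 2) (spFreq η) *
    sameSignWeight p (spFreq ξ) (σ * ξ 0) (spFreq η) (spFreq (ξ - η))) *
  modulationWeight p σ σ ξ η

def oppSignKernel (p σ : ℝ) (ξ η : SpaceTime) : ℝ≥0∞ :=
  ENNReal.ofReal (decay (p + 1 / 2) (spFreq η) *
    oppSignWeight p (spFreq ξ) (σ * ξ 0) (spFreq η) (spFreq (ξ - η))) *
  modulationWeight p σ (-σ) ξ η

theorem measurable_sameSignKernel (p σ : ℝ) :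
    Measurable (Function.uncurry (sameSignKernel p σ)) := by
  simp only [sameSignKernel, sameSignWeight, modulationWeight, Function.uncurry_def]
  fun_prop

theorem measurable_oppSignKernel (p σ : ℝ) :
    Measurable (Function.uncurry (oppSignKernel p σ)) := by
  simp only [oppSignKernel, oppSignWeight, modulationWeight, Function.uncurry_def]
  fun_prop

theorem triBounded_sameSignKernel {p : ℝ} (hp : 1 < p) (σ : ℝ) :
    TriBounded volume (sameSignKernel p σ) := by
  obtain ⟨D, hD, hle⟩ := exists_lintegral_sameSign_le hp
  have hI := lintegral_decay_ne_top hp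
  refine TriBounded.of_lintegral_le (measurable_sameSignKernel p σ)
    (D := (2 * ∫⁻ x, ENNReal.ofReal (decay p x)) * D) (by finiteness) ?_
  filter_upwards [ae_spFreq_pos] with ξ hξ
  refine (lintegral_modulation_le hξ σ σ (F := fun r ρ => ENNReal.ofReal
    (decay (p + 1 / 2) r * sameSignWeight p (spFreq ξ) (σ * ξ 0) r ρ)) ?_).trans
    (mul_le_mul_right (hle _ _ hξ) _)
  simp only [sameSignWeight, Function.uncurry_def]
  fun_prop

/-- The set where the input frequencies are comparable to the output frequency. -/
def nearSet : Set (SpaceTime × SpaceTime) :=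
  {x | spFreq x.2 + spFreq (x.1 - x.2) ≤ 2 * spFreq x.1}

theorem measurableSet_nearSet : MeasurableSet nearSet :=
  measurableSet_le (by fun_prop) (by fun_prop)

theorem triBounded_oppSignKernel_near {p : ℝ} (hp : 1 < p) (σ : ℝ) :
    TriBounded volume fun ξ η => nearSet.indicator (Function.uncurry (oppSignKernel p σ)) (ξ, η) := by
  obtain ⟨D, hD, hle⟩ := exists_lintegral_oppSign_near_le hp
  have hI := lintegral_decay_ne_top hp
  refine TriBounded.of_lintegral_le
    ((measurable_oppSignKernel p σ).indicator measurableSet_nearSet)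
    (D := (2 * ∫⁻ x, ENNReal.ofReal (decay p x)) * D) (by finiteness) ?_
  filter_upwards [ae_spFreq_pos] with ξ hξ
  refine le_trans (le_of_eq ?_) ((lintegral_modulation_le hξ σ (-σ) (F := fun r ρ =>
    if r + ρ ≤ 2 * spFreq ξ then ENNReal.ofReal
      (decay (p + 1 / 2) r * oppSignWeight p (spFreq ξ) (σ * ξ 0) r ρ) else 0) ?_).trans
    (mul_le_mul_right (hle _ _ hξ) _))
  · refine lintegral_congr fun η => ?_
    by_cases h : spFreq η + spFreq (ξ - η) ≤ 2 * spFreq ξ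
    · rw [indicator_of_mem (show (ξ, η) ∈ nearSet from h), if_pos h]
      rfl
    · rw [indicator_of_notMem (show (ξ, η) ∉ nearSet from h), if_neg h, zero_mul]
  · simp only [oppSignWeight, Function.uncurry_def]
    exact Measurable.ite (measurableSet_le (by fun_prop) (by fun_prop)) (by fun_prop)
      measurable_const

theorem triBounded_oppSignKernel_far {p : ℝ} (hp : 1 < p) (hp2 : p ≤ 2) (σ : ℝ) :
    TriBounded volume fun ξ η =>
      nearSetᶜ.indicator (Function.uncurry (oppSignKernel p σ)) (ξ, η) := by
  obtain ⟨D, hD, hle⟩ := exists_lintegral_oppSign_far_le hp hp2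
  set I := ∫⁻ x, ENNReal.ofReal (decay p x) with hI
  have hI' : I ≠ ∞ := lintegral_decay_ne_top hp
  set e : ℤ → ℝ := fun j =>
    (√((2 : ℝ) ^ j) * decay (p - 1 / 2) ((2 : ℝ) ^ j)) with he
  have he0 (j : ℤ) : 0 ≤ e j := mul_nonneg (sqrt_nonneg _) (decay_nonneg _ _)
  set P : ℤ → Set (SpaceTime × SpaceTime) := fun j =>
    {x | spFreq x.1 ∈ Ico ((2 : ℝ) ^ j) ((2 : ℝ) ^ (j + 1))} with hP
  have hPm (j : ℤ) : MeasurableSet (P j ∩ nearSetᶜ) :=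
    (measurableSet_Ico.preimage (by fun_prop)).inter measurableSet_nearSet.compl
  set Q : ℤ → SpaceTime → SpaceTime → ℝ≥0∞ := fun j ξ η =>
    (P j ∩ nearSetᶜ).indicator (Function.uncurry (oppSignKernel p σ)) (ξ, η) with hQ
  have hQm (j : ℤ) : Measurable (Function.uncurry (Q j)) :=
    (measurable_oppSignKernel p σ).indicator (hPm j)
  have hQle (j : ℤ) {h f g : SpaceTime → ℝ≥0∞} (hh : Measurable h) (hf : Measurable f)
      (hg : Measurable g) : triForm volume (Q j) h f g ≤
      2 * (2 * I * (D * ENNReal.ofReal (2 * e j))) ^ (1 / 2 : ℝ) *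
        (l2Size volume h * l2Size volume f * l2Size volume g) := by
    have h2 : (0 : ℝ) < 2 ^ j := by positivity
    have h21 : (2 : ℝ) ^ (j + 1) = 2 * 2 ^ j := by rw [zpow_add₀ two_ne_zero]; ring
    refine triForm_le_of_shell (hQm j) hh hf hg measurable_spFreq (L := 2 ^ (j + 1)) (by positivity)
      (fun ξ η hne => ?_) _ ?_
    · have hmem := mem_of_indicator_ne_zero hne
      exact (abs_spFreq_sub_sub_le ξ η).trans hmem.1.2.le
    filter_upwards [ae_spFreq_pos] with ξ hξ a
    by_cases hmem : spFreq ξ ∈ Ico ((2 : ℝ) ^ j) ((2 : ℝ) ^ (j + 1))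
    swap
    · rw [lintegral_congr (g := fun _ => 0) fun η => indicator_of_notMem (fun h => hmem h.1) _]
      simp
    have hset : MeasurableSet {η : SpaceTime | a ≤ spFreq η ∧ spFreq η ≤ a + 2 ^ (j + 1)} :=
      measurableSet_Icc.preimage measurable_spFreq
    rw [← lintegral_indicator hset]
    refine le_trans (lintegral_mono fun η => ?_) ((lintegral_modulation_le hξ σ (-σ)
      (F := fun r ρ => if 2 * spFreq ξ < r + ρ ∧ r ∈ Icc a (a + 2 ^ (j + 1)) then ENNReal.ofReal
      (decay (p + 1 / 2) r * oppSignWeight p (spFreq ξ) (σ * ξ 0) r ρ) else 0) ?_).trans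
      (mul_le_mul_right ((hle _ _ _ _ hξ (by positivity)).trans
        (mul_le_mul_right (ENNReal.ofReal_le_ofReal ?_) _)) _))
    · by_cases h1 : a ≤ spFreq η ∧ spFreq η ≤ a + 2 ^ (j + 1)
      swap
      · rw [indicator_of_notMem (by exact h1)]
        exact zero_le
      rw [indicator_of_mem (by exact h1)]
      by_cases h : 2 * spFreq ξ < spFreq η + spFreq (ξ - η)
      · rw [if_pos ⟨h, h1⟩]
        exact indicator_le_self _ _ _
      · refine (le_of_eq (indicator_of_notMem (fun hm => hm.2 (not_lt.1 h)) _)).trans zero_le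
    · simp only [oppSignWeight, Function.uncurry_def]
      refine Measurable.ite (MeasurableSet.inter (s₁ := {x : ℝ × ℝ | 2 * spFreq ξ < x.1 + x.2})
        (measurableSet_lt (by fun_prop) (by fun_prop))
        (measurableSet_Icc.preimage measurable_fst)) (by fun_prop) measurable_const
    · have d1 : decay (p - 1 / 2) (spFreq ξ) ≤ decay (p - 1 / 2) (2 ^ j) :=
        decay_le_of_abs_le (by linarith) (by rw [abs_of_pos h2, abs_of_pos hξ]; exact hmem.1)
      have d2 : (√(spFreq ξ))⁻¹ ≤ (√(2 ^ j))⁻¹ :=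
        inv_anti₀ (sqrt_pos.2 h2) (Real.sqrt_le_sqrt hmem.1)
      have d0 := decay_nonneg (p - 1 / 2) (spFreq ξ)
      calc _ ≤ (2 * 2 ^ j) * ((√(2 ^ j))⁻¹ * decay (p - 1 / 2) (2 ^ j)) := by
            rw [h21]; gcongr
        _ = 2 * ((√(2 ^ j) * √(2 ^ j)) * (√(2 ^ j))⁻¹ * decay (p - 1 / 2) (2 ^ j)) := by
            rw [Real.mul_self_sqrt h2.le]; ring
        _ = _ := by
            rw [mul_assoc √_, mul_inv_cancel₀ (sqrt_pos.2 h2).ne', mul_one]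
  set c : ℝ≥0∞ := 2 * (2 * I * D * 2) ^ (1 / 2 : ℝ) with hc
  have hct : c ≠ ∞ := by
    refine ENNReal.mul_ne_top (by simp) (ENNReal.rpow_ne_top_of_nonneg (by norm_num) ?_)
    finiteness
  refine ⟨c * ∑' j, ENNReal.ofReal (e j ^ (1 / 2 : ℝ)),
    ENNReal.mul_ne_top hct (summable_dyadic hp).tsum_ofReal_ne_top, fun h f g hh hf hg => ?_⟩
  refine (triForm_le_tsum (Q' := Q) (f' := fun _ => f) (g' := fun _ => g) hQm hh (fun _ => hf)
    (fun _ => hg) ?_).trans ?_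
  · filter_upwards [ae_spFreq_pos] with ξ hξ η
    obtain ⟨j, hj⟩ := exists_mem_Ico_zpow hξ one_lt_two
    refine ⟨j, mul_le_mul_left (le_of_eq ?_) _⟩
    by_cases hn : (ξ, η) ∈ nearSetᶜ
    · rw [indicator_of_mem hn]
      exact (indicator_of_mem (show (ξ, η) ∈ P j ∩ nearSetᶜ from ⟨hj, hn⟩) _).symm
    · rw [indicator_of_notMem hn]
      exact (indicator_of_notMem (show (ξ, η) ∉ P j ∩ nearSetᶜ from fun h => hn h.2) _).symm
  · rw [← ENNReal.tsum_mul_left, ← ENNReal.tsum_mul_right]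
    refine ENNReal.tsum_le_tsum fun j => (hQle j hh hf hg).trans_eq ?_
    congr 1
    rw [hc, mul_assoc (2 : ℝ≥0∞) (_ ^ _), ← ENNReal.ofReal_rpow_of_nonneg (he0 j) (by norm_num),
      ← ENNReal.mul_rpow_of_nonneg _ _ (by norm_num), ENNReal.ofReal_mul (by norm_num)]
    simp only [mul_assoc, ENNReal.ofReal_ofNat]

theorem triBounded_oppSignKernel {p : ℝ} (hp : 1 < p) (hp2 : p ≤ 2) (σ : ℝ) :
    TriBounded volume (oppSignKernel p σ) := by
  refine ((TriBounded.add
    (Q := fun ξ η => nearSet.indicator (Function.uncurry (oppSignKernel p σ)) (ξ, η))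
    ((measurable_oppSignKernel p σ).indicator measurableSet_nearSet)
    (triBounded_oppSignKernel_near hp σ) (triBounded_oppSignKernel_far hp hp2 σ)).mono (Filter.Eventually.of_forall fun ξ η => ?_))
  rw [indicator_self_add_compl_apply]
  rfl

/-- The weight whose product with `‖û‖²` is integrated in the wave-Sobolev norm. -/
def waveWeight (s b : ℝ) (ζ : SpaceTime) : ℝ :=
  (1 + (spFreq ζ) ^ 2) ^ s * (1 + |(|ζ 0| - spFreq ζ)|) ^ (2 * b)

theorem waveWeight_pos (s b : ℝ) (ζ : SpaceTime) : 0 < waveWeight s b ζ := by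
  unfold waveWeight; positivity

@[fun_prop]
theorem measurable_waveWeight (s b : ℝ) : Measurable (waveWeight s b) := by
  unfold waveWeight; fun_prop

/-- The squared kernel of the basic bilinear estimate, with the low-frequency weight on `η`. -/
def productWeight (p : ℝ) (ξ η : SpaceTime) : ℝ :=
  √(1 + |(|ξ 0| - spFreq ξ)|) * decay p (|(ξ - η) 0| - spFreq (ξ - η)) *
    decay p (|η 0| - spFreq η) * decay (p + 1 / 2) (spFreq η)

theorem productWeight_nonneg (p : ℝ) (ξ η : SpaceTime) : 0 ≤ productWeight p ξ η := by
  have h1 := decay_nonneg p (|(ξ - η) 0| - spFreq (ξ - η))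
  have h2 := decay_nonneg p (|η 0| - spFreq η)
  have h3 := decay_nonneg (p + 1 / 2) (spFreq η)
  unfold productWeight; positivity

theorem measurable_productWeight (p : ℝ) : Measurable (Function.uncurry (productWeight p)) := by
  simp only [productWeight, Function.uncurry_def]
  fun_prop

theorem exists_sign_decay_eq (p τ q : ℝ) :
    ∃ σ : ℝ, (σ = 1 ∨ σ = -1) ∧ decay p (|τ| - q) = decay p (τ - σ * q) := by
  rcases abs_cases τ with h | h
  · exact ⟨1, Or.inl rfl, by rw [h.1, one_mul]⟩
  · refine ⟨-1, Or.inr rfl, ?_⟩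
    rw [h.1, ← decay_neg]
    congr 1; ring

theorem ofReal_productWeight_le_sameSign {p : ℝ} (hp : 1 ≤ p) (hp2 : p ≤ 2) {σ : ℝ}
    (hσ : σ = 1 ∨ σ = -1) {ξ η : SpaceTime}
    (h1 : decay p (|(ξ - η) 0| - spFreq (ξ - η)) = decay p ((ξ - η) 0 - σ * spFreq (ξ - η)))
    (h2 : decay p (|η 0| - spFreq η) = decay p (η 0 - σ * spFreq η)) :
    ENNReal.ofReal (productWeight p ξ η) ≤ 8 * sameSignKernel p σ ξ η := by
  have hr := spFreq_nonneg η
  have hρ := spFreq_nonneg (ξ - η)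
  have htri := spFreq_le_add ξ η
  have hξ0 : (ξ - η) 0 + η 0 = ξ 0 := by simp
  set r := spFreq η
  set ρ := spFreq (ξ - η)
  set M := spFreq ξ
  have hσ' : |σ| = 1 := by rcases hσ with rfl | rfl <;> simp
  have hσσ : σ * σ = 1 := by rcases hσ with rfl | rfl <;> norm_num
  have hb : |(|σ * ρ + σ * r| - M)| ≤ r + ρ - M := by
    rw [← mul_add, abs_mul, hσ', one_mul, abs_of_nonneg (add_nonneg hρ hr), add_comm ρ,
      abs_of_nonneg (by linarith)]
  have hW := abs_abs_sub_le (τ₁ := (ξ - η) 0) (τ₂ := η 0) hb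
  rw [hξ0] at hW
  have key := sqrt_mul_decay_mul_decay_le hp hp2 (W := 1 + |(|ξ 0| - M)|)
    (b := r + ρ - M) (y₁ := (ξ - η) 0 - σ * ρ) (y₂ := η 0 - σ * r) (by linarith) (by linarith)
  have habs : |((ξ - η) 0 - σ * ρ + (η 0 - σ * r))| = |r + ρ - σ * ξ 0| := by
    rw [← one_mul |_ + _|, ← hσ', ← abs_mul, ← abs_neg, ← hξ0]
    congr 1
    linear_combination (r + ρ) * hσσ
  have hdec (q : ℝ) : decay q ((ξ - η) 0 - σ * ρ + (η 0 - σ * r)) =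
      decay q (r + ρ - σ * ξ 0) := by
    unfold decay; rw [habs]
  rw [hdec, hdec] at key
  have d1 := decay_nonneg p ((ξ - η) 0 - σ * ρ)
  have d2 := decay_nonneg p (η 0 - σ * r)
  have d3 := decay_nonneg (p + 1 / 2) r
  have d4 : 0 ≤ sameSignWeight p M (σ * ξ 0) r ρ := by
    have := decay_nonneg (p - 1 / 2) (r + ρ - σ * ξ 0)
    have := decay_nonneg p (r + ρ - σ * ξ 0)
    unfold sameSignWeight; positivity
  rw [sameSignKernel, modulationWeight, ← ENNReal.ofReal_add d1 d2,
    ← ENNReal.ofReal_mul (by positivity), show (8 : ℝ≥0∞) = ENNReal.ofReal 8 by simp,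
    ← ENNReal.ofReal_mul (by positivity)]
  refine ENNReal.ofReal_le_ofReal ?_
  rw [productWeight, h1, h2]
  refine (mul_le_mul_of_nonneg_right key d3).trans_eq ?_
  rw [sameSignWeight]
  ring

theorem ofReal_productWeight_le_oppSign {p : ℝ} (hp : 1 ≤ p) (hp2 : p ≤ 2) {σ : ℝ}
    (hσ : σ = 1 ∨ σ = -1) {ξ η : SpaceTime}
    (h1 : decay p (|(ξ - η) 0| - spFreq (ξ - η)) = decay p ((ξ - η) 0 - σ * spFreq (ξ - η)))
    (h2 : decay p (|η 0| - spFreq η) = decay p (η 0 - -σ * spFreq η)) :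
    ENNReal.ofReal (productWeight p ξ η) ≤ 8 * oppSignKernel p σ ξ η := by
  have htri := abs_spFreq_sub_sub_le ξ η
  have hξ0 : (ξ - η) 0 + η 0 = ξ 0 := by simp
  set r := spFreq η
  set ρ := spFreq (ξ - η)
  set M := spFreq ξ
  have hσ' : |σ| = 1 := by rcases hσ with rfl | rfl <;> simp
  have hσσ : σ * σ = 1 := by rcases hσ with rfl | rfl <;> norm_num
  have hb : |(|σ * ρ + -σ * r| - M)| ≤ M - |ρ - r| := by
    rw [neg_mul, ← sub_eq_add_neg, ← mul_sub, abs_mul, hσ', one_mul, abs_sub_comm,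
      abs_of_nonneg (by linarith)]
  have hW := abs_abs_sub_le (τ₁ := (ξ - η) 0) (τ₂ := η 0) hb
  rw [hξ0] at hW
  have key := sqrt_mul_decay_mul_decay_le hp hp2 (W := 1 + |(|ξ 0| - M)|)
    (b := M - |ρ - r|) (y₁ := (ξ - η) 0 - σ * ρ) (y₂ := η 0 - -σ * r) (by linarith) (by linarith)
  have habs : |((ξ - η) 0 - σ * ρ + (η 0 - -σ * r))| = |ρ - r - σ * ξ 0| := by
    rw [← one_mul |_ + _|, ← hσ', ← abs_mul, ← abs_neg, ← hξ0]
    congr 1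
    linear_combination (ρ - r) * hσσ
  have hdec (q : ℝ) : decay q ((ξ - η) 0 - σ * ρ + (η 0 - -σ * r)) =
      decay q (ρ - r - σ * ξ 0) := by
    unfold decay; rw [habs]
  rw [hdec, hdec] at key
  have d1 := decay_nonneg p ((ξ - η) 0 - σ * ρ)
  have d2 := decay_nonneg p (η 0 - -σ * r)
  have d3 := decay_nonneg (p + 1 / 2) r
  have d4 := oppSignWeight_nonneg p M (σ * ξ 0) r ρ
  rw [oppSignKernel, modulationWeight, ← ENNReal.ofReal_add d1 d2,
    ← ENNReal.ofReal_mul (by positivity), show (8 : ℝ≥0∞) = ENNReal.ofReal 8 by simp,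
    ← ENNReal.ofReal_mul (by positivity)]
  refine ENNReal.ofReal_le_ofReal ?_
  rw [productWeight, h1, h2]
  refine (mul_le_mul_of_nonneg_right key d3).trans_eq ?_
  rw [oppSignWeight]
  ring

theorem triBounded_productWeight {p : ℝ} (hp : 1 < p) (hp2 : p ≤ 2) :
    TriBounded volume fun ξ η => ENNReal.ofReal (productWeight p ξ η) := by
  have hs := (triBounded_sameSignKernel hp 1).add (measurable_sameSignKernel p 1)
    (triBounded_sameSignKernel hp (-1))
  have ho := (triBounded_oppSignKernel hp hp2 1).add (measurable_oppSignKernel p 1)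
    (triBounded_oppSignKernel hp hp2 (-1))
  have hsm : Measurable (Function.uncurry fun ξ η => sameSignKernel p 1 ξ η +
      sameSignKernel p (-1) ξ η) :=
    (measurable_sameSignKernel p 1).add (measurable_sameSignKernel p (-1))
  have hom : Measurable (Function.uncurry fun ξ η => oppSignKernel p 1 ξ η +
      oppSignKernel p (-1) ξ η) :=
    (measurable_oppSignKernel p 1).add (measurable_oppSignKernel p (-1))
  refine ((hs.add hsm ho).const_mul (c := 8) (by simp)).mono
    (Filter.Eventually.of_forall fun ξ η => ?_)
  obtain ⟨σ, hσ, h1⟩ := exists_sign_decay_eq p ((ξ - η) 0) (spFreq (ξ - η))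
  obtain ⟨σ', hσ', h2⟩ := exists_sign_decay_eq p (η 0) (spFreq η)
  by_cases h : σ' = σ
  · subst h
    refine (ofReal_productWeight_le_sameSign hp.le hp2 hσ h1 h2).trans (mul_le_mul_right ?_ _)
    refine le_trans ?_ le_self_add
    rcases hσ with rfl | rfl
    · exact le_self_add
    · exact le_add_self
  · obtain rfl : σ' = -σ := by
      rcases hσ with rfl | rfl <;> rcases hσ' with rfl | rfl <;> simp_all
    refine (ofReal_productWeight_le_oppSign hp.le hp2 hσ h1 h2).trans (mul_le_mul_right ?_ _)
    refine le_trans ?_ le_add_self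
    rcases hσ with rfl | rfl
    · exact le_self_add
    · exact le_add_self

theorem one_add_sq_rpow_neg_le {β q r : ℝ} (hβ : 0 ≤ β) (hβ2 : β ≤ 2) (hq : q ≤ 2 * β)
    (hr : 0 ≤ r) : (1 + r ^ 2) ^ (-β) ≤ 4 * decay q r := by
  calc (1 + r ^ 2) ^ (-β) ≤ ((1 + r) ^ 2 / 2) ^ (-β) :=
        Real.rpow_le_rpow_of_nonpos (by positivity) (by nlinarith [sq_nonneg (r - 1)])
          (by linarith)
    _ = 2 ^ β * (1 + r) ^ (-(2 * β)) := by
        rw [Real.div_rpow (by positivity) (by norm_num), Real.rpow_neg zero_le_two,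
          div_inv_eq_mul, mul_comm, ← Real.rpow_natCast, ← Real.rpow_mul (by positivity)]
        norm_num
    _ ≤ 2 ^ (2 : ℝ) * (1 + r) ^ (-q) := by
        gcongr
        · norm_num
        · linarith
    _ = 4 * decay q r := by rw [decay, abs_of_nonneg hr]; norm_num

theorem rpow_one_add_sq_mul_le {a β q M r ρ : ℝ} (ha : 0 ≤ a) (ha1 : a ≤ 1) (haβ : a ≤ β)
    (hβ2 : β ≤ 2) (hq : q ≤ 2 * β) (hM : 0 ≤ M) (hr : 0 ≤ r) (hρ : 0 ≤ ρ) (hle : M ≤ r + ρ) :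
    (1 + M ^ 2) ^ a * ((1 + ρ ^ 2) ^ a)⁻¹ * ((1 + r ^ 2) ^ β)⁻¹ ≤
      16 * (decay q r + decay q ρ) := by
  have hmax {x : ℝ} (hx : M ≤ 2 * x) : (1 + M ^ 2) ^ a ≤ 4 * (1 + x ^ 2) ^ a := by
    calc (1 + M ^ 2) ^ a ≤ (4 * (1 + x ^ 2)) ^ a :=
          Real.rpow_le_rpow (by positivity) (by nlinarith) ha
      _ = 4 ^ a * (1 + x ^ 2) ^ a := Real.mul_rpow (by norm_num) (by positivity)
      _ ≤ 4 ^ (1 : ℝ) * (1 + x ^ 2) ^ a := by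
          gcongr
          norm_num
      _ = _ := by norm_num
  rcases le_total r ρ with h | h
  · have h1 : (1 + M ^ 2) ^ a * ((1 + ρ ^ 2) ^ a)⁻¹ ≤ 4 := by
      rw [← div_eq_mul_inv, div_le_iff₀ (by positivity)]
      exact hmax (by linarith)
    rw [← Real.rpow_neg (x := 1 + r ^ 2) (by positivity)]
    calc _ ≤ 4 * (4 * decay q r) := by
          gcongr
          exact one_add_sq_rpow_neg_le (ha.trans haβ) hβ2 hq hr
      _ ≤ _ := by linarith [decay_nonneg q ρ]
  · have h1 : (1 + M ^ 2) ^ a * ((1 + r ^ 2) ^ β)⁻¹ ≤ 4 * (1 + ρ ^ 2) ^ (a - β) := by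
      calc _ ≤ 4 * (1 + r ^ 2) ^ a * ((1 + r ^ 2) ^ β)⁻¹ := by
            gcongr
            exact hmax (by linarith)
        _ = 4 * (1 + r ^ 2) ^ (a - β) := by
            rw [Real.rpow_sub (by positivity)]; ring
        _ ≤ _ := by
            refine mul_le_mul_of_nonneg_left ?_ (by norm_num)
            exact Real.rpow_le_rpow_of_nonpos (by positivity) (by gcongr) (by linarith)
    calc _ = ((1 + M ^ 2) ^ a * ((1 + r ^ 2) ^ β)⁻¹) * ((1 + ρ ^ 2) ^ a)⁻¹ := by ring
      _ ≤ 4 * (1 + ρ ^ 2) ^ (a - β) * ((1 + ρ ^ 2) ^ a)⁻¹ := by gcongr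
      _ = 4 * (1 + ρ ^ 2) ^ (-β) := by
          rw [mul_assoc, ← Real.rpow_neg (by positivity), ← Real.rpow_add (by positivity)]
          congr 2; ring
      _ ≤ 4 * (4 * decay q ρ) := by
          gcongr
          exact one_add_sq_rpow_neg_le (ha.trans haβ) hβ2 hq hρ
      _ ≤ _ := by linarith [decay_nonneg q r]

theorem waveWeight_mul_le {p a β γ θ₀ θ₁ : ℝ} (ha : 0 ≤ a) (ha1 : a ≤ 1) (haβ : a ≤ β)
    (hβ2 : β ≤ 2) (hγ : γ ≤ 1 / 4) (hp : p ≤ 2 * θ₀) (hp' : p ≤ 2 * θ₁) (hpβ : p + 1 / 2 ≤ 2 * β)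
    (ξ η : SpaceTime) :
    waveWeight a γ ξ * (waveWeight a θ₀ (ξ - η))⁻¹ * (waveWeight β θ₁ η)⁻¹ ≤
      16 * (productWeight p ξ η + productWeight p ξ (ξ - η)) := by
  have hinv {b x : ℝ} (hb : p ≤ 2 * b) : ((1 + |x|) ^ (2 * b))⁻¹ ≤ decay p x := by
    rw [decay, Real.rpow_neg (by positivity)]
    exact inv_anti₀ (by positivity)
      (Real.rpow_le_rpow_of_exponent_le (by linarith [abs_nonneg x]) hb)
  have h0 : (1 + |(|ξ 0| - spFreq ξ)|) ^ (2 * γ) ≤ √(1 + |(|ξ 0| - spFreq ξ)|) := by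
    rw [Real.sqrt_eq_rpow]
    exact Real.rpow_le_rpow_of_exponent_le (by linarith [abs_nonneg (|ξ 0| - spFreq ξ)])
      (by linarith)
  have hfreq := rpow_one_add_sq_mul_le ha ha1 haβ hβ2 hpβ (spFreq_nonneg ξ) (spFreq_nonneg η)
    (spFreq_nonneg (ξ - η)) (spFreq_le_add ξ η)
  have d1 := decay_nonneg p (|(ξ - η) 0| - spFreq (ξ - η))
  have d2 := decay_nonneg p (|η 0| - spFreq η)
  have d3 := decay_nonneg (p + 1 / 2) (spFreq η)
  have d4 := decay_nonneg (p + 1 / 2) (spFreq (ξ - η))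
  calc _ = ((1 + spFreq ξ ^ 2) ^ a * ((1 + spFreq (ξ - η) ^ 2) ^ a)⁻¹ *
          ((1 + spFreq η ^ 2) ^ β)⁻¹) *
        ((1 + |(|ξ 0| - spFreq ξ)|) ^ (2 * γ) *
          ((1 + |(|(ξ - η) 0| - spFreq (ξ - η))|) ^ (2 * θ₀))⁻¹ *
          ((1 + |(|η 0| - spFreq η)|) ^ (2 * θ₁))⁻¹) := by
        simp only [waveWeight, mul_inv]; ring
    _ ≤ (16 * (decay (p + 1 / 2) (spFreq η) + decay (p + 1 / 2) (spFreq (ξ - η)))) *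
        (√(1 + |(|ξ 0| - spFreq ξ)|) * decay p (|(ξ - η) 0| - spFreq (ξ - η)) *
          decay p (|η 0| - spFreq η)) := by
        gcongr
        · exact hinv hp
        · exact hinv hp'
    _ = _ := by
        simp only [productWeight, sub_sub_cancel]; ring

theorem triBounded_waveWeight {a β γ θ₀ θ₁ : ℝ} (ha : 0 ≤ a) (ha1 : a ≤ 1) (haβ : a ≤ β)
    (hβ2 : β ≤ 2) (hγ : γ ≤ 1 / 4) (hθ₀ : 1 / 2 < θ₀) (hθ₁ : 1 / 2 < θ₁) (hβ : 3 / 4 < β) :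
    TriBounded volume fun ξ η => ENNReal.ofReal
      (waveWeight a γ ξ * (waveWeight a θ₀ (ξ - η))⁻¹ * (waveWeight β θ₁ η)⁻¹) := by
  obtain ⟨p, hp, hpm⟩ := exists_between (show (1 : ℝ) <
    min (min 2 (2 * θ₀)) (min (2 * θ₁) (2 * β - 1 / 2)) by
      simp only [lt_min_iff]; constructor <;> constructor <;> linarith)
  simp only [lt_min_iff] at hpm
  have h := triBounded_productWeight hp hpm.1.1.le
  have hm : Measurable (Function.uncurry fun ξ η => ENNReal.ofReal (productWeight p ξ η)) :=
    (measurable_productWeight p).ennreal_ofReal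
  have hm' : Measurable (Function.uncurry fun ξ η =>
      ENNReal.ofReal (productWeight p ξ (ξ - η))) :=
    hm.comp (f := fun x : SpaceTime × SpaceTime => (x.1, x.1 - x.2)) (by fun_prop)
  refine ((h.add hm h.comm).const_mul (c := 16) (by simp)).mono
    (Filter.Eventually.of_forall fun ξ η => ?_)
  rw [← ENNReal.ofReal_add (productWeight_nonneg _ _ _) (productWeight_nonneg _ _ _),
    show (16 : ℝ≥0∞) = ENNReal.ofReal 16 by simp, ← ENNReal.ofReal_mul (by norm_num)]
  exact ENNReal.ofReal_le_ofReal (waveWeight_mul_le ha ha1 haβ hβ2 hγ hpm.1.2.le hpm.2.1.le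
    (by linarith [hpm.2.2]) ξ η)

/-- The Fourier transform turns products of Schwartz functions into convolutions. -/
theorem fourier_pairing_mul (u v : SchwartzMap SpaceTime ℂ) (ξ : SpaceTime) :
    𝓕 (fun x => u x * v x) ξ = ∫ η, 𝓕 v η * 𝓕 u (ξ - η) := by
  have inv (w : SchwartzMap SpaceTime ℂ) (x : SpaceTime) : 𝓕 (𝓕 w) x = w (-x) := by
    have h : 𝓕⁻ (𝓕 w) (-x) = w (-x) := by simp
    rw [← h, SchwartzMap.fourierInv_coe, Real.fourierInv_eq_fourier_neg, neg_neg,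
      SchwartzMap.fourier_coe]
  have h := SchwartzMap.convolution_apply (ContinuousLinearMap.mul ℂ ℂ) (𝓕 v) (𝓕 u) ξ
  rw [MeasureTheory.convolution_def] at h
  simp only [ContinuousLinearMap.mul_apply'] at h
  rw [← h]
  change _ = 𝓕⁻ (SchwartzMap.pairing (ContinuousLinearMap.mul ℂ ℂ) (𝓕 (𝓕 v)) (𝓕 (𝓕 u))) ξ
  rw [SchwartzMap.fourierInv_coe, Real.fourierInv_eq_fourier_comp_neg]
  refine congrFun (congrArg 𝓕 (funext fun x => ?_)) ξ
  simp [inv, mul_comm]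

theorem waveWeight_le (s b : ℝ) : ∃ k : ℕ, ∃ C : ℝ, ∀ ζ, waveWeight s b ζ ≤ C * (1 + ‖ζ‖) ^ k := by
  have hsp (ζ : SpaceTime) : spFreq ζ ≤ ‖ζ‖ := by
    rw [spFreq, EuclideanSpace.norm_eq]
    refine Real.sqrt_le_sqrt ?_
    simp only [Fin.sum_univ_three, Real.norm_eq_abs, sq_abs]
    nlinarith [sq_nonneg (ζ 0)]
  have h0 (ζ : SpaceTime) : |ζ 0| ≤ ‖ζ‖ := by simpa using PiLp.norm_apply_le ζ 0
  have hn (ζ : SpaceTime) : 0 ≤ spFreq ζ := Real.sqrt_nonneg _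
  have aux (x y r : ℝ) (hx : 1 ≤ x) (hxy : x ≤ y) : x ^ r ≤ y ^ ⌈|r|⌉₊ := by
    calc x ^ r ≤ x ^ (⌈|r|⌉₊ : ℝ) :=
          Real.rpow_le_rpow_of_exponent_le hx ((le_abs_self r).trans (Nat.le_ceil _))
      _ ≤ y ^ (⌈|r|⌉₊ : ℝ) := by gcongr
      _ = _ := Real.rpow_natCast _ _
  refine ⟨2 * ⌈|s|⌉₊ + ⌈|2 * b|⌉₊, 1, fun ζ => ?_⟩
  rw [one_mul, pow_add, pow_mul]
  have h1 : |(|ζ 0| - spFreq ζ)| ≤ ‖ζ‖ := by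
    rw [abs_le]; constructor <;> linarith [hsp ζ, h0 ζ, hn ζ, abs_nonneg (ζ 0)]
  refine mul_le_mul (aux _ _ s ?_ ?_) (aux _ _ (2 * b) ?_ ?_) (by positivity) (by positivity)
  · nlinarith [hn ζ]
  · nlinarith [hn ζ, hsp ζ]
  · linarith [abs_nonneg (|ζ 0| - spFreq ζ)]
  · linarith

theorem integrable_waveWeight_mul (s b : ℝ) (f : SchwartzMap SpaceTime ℂ) :
    Integrable fun ζ => waveWeight s b ζ * ‖f ζ‖ ^ 2 := by
  obtain ⟨k, C, hC⟩ := waveWeight_le s b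
  have hpow : Integrable fun ζ : SpaceTime => (1 + ‖ζ‖) ^ k * ‖f ζ‖ := by
    have (ζ : SpaceTime) : (1 + ‖ζ‖) ^ k * ‖f ζ‖ =
        ∑ i ∈ Finset.range (k + 1), (k.choose i : ℝ) * (‖ζ‖ ^ i * ‖f ζ‖) := by
      rw [add_comm, add_pow, Finset.sum_mul]
      refine Finset.sum_congr rfl fun i _ => ?_
      simp; ring
    simp only [this]
    exact integrable_finsetSum _ fun i _ => (f.integrable_pow_mul volume i).const_mul _
  have hbd (ζ : SpaceTime) : ‖f ζ‖ ≤ SchwartzMap.seminorm ℝ 0 0 f := f.norm_le_seminorm ℝ ζ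
  refine ((hpow.const_mul (|C| * SchwartzMap.seminorm ℝ 0 0 f)).mono' ?_ (ae_of_all _ fun ζ => ?_))
  · exact ((measurable_waveWeight s b).mul
      (f.continuous.norm.pow 2).measurable).aestronglyMeasurable
  · have hw := waveWeight_pos s b ζ
    rw [Real.norm_of_nonneg (by positivity)]
    calc waveWeight s b ζ * ‖f ζ‖ ^ 2
        ≤ |C| * (1 + ‖ζ‖) ^ k * (SchwartzMap.seminorm ℝ 0 0 f * ‖f ζ‖) := by
          rw [sq]
          gcongr
          · exact (hC ζ).trans (by gcongr; exact le_abs_self C)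
          · exact hbd ζ
      _ = _ := by ring

/-- The weighted modulus of a Fourier transform whose `L²` size is the wave-Sobolev norm. -/
def weightedFourier (s b : ℝ) (f : SchwartzMap SpaceTime ℂ) (ζ : SpaceTime) : ℝ≥0∞ :=
  ENNReal.ofReal (waveWeight s b ζ) ^ (1 / 2 : ℝ) * ‖𝓕 f ζ‖ₑ

@[fun_prop]
theorem measurable_weightedFourier (s b : ℝ) (f : SchwartzMap SpaceTime ℂ) :
    Measurable (weightedFourier s b f) :=
  ((measurable_waveWeight s b).ennreal_ofReal.pow_const _).mul
    (𝓕 f).continuous.enorm.measurable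

theorem lintegral_weightedFourier_sq (s b : ℝ) (f : SchwartzMap SpaceTime ℂ) :
    ∫⁻ ζ, weightedFourier s b f ζ ^ 2 =
      ENNReal.ofReal (∫ ζ, waveWeight s b ζ * ‖𝓕 f ζ‖ ^ 2) := by
  rw [ofReal_integral_eq_lintegral_ofReal (integrable_waveWeight_mul s b (𝓕 f))
    (ae_of_all _ fun ζ => mul_nonneg (waveWeight_pos s b ζ).le (by positivity))]
  refine lintegral_congr fun ζ => ?_
  rw [weightedFourier, mul_pow, ENNReal.rpow_half_sq, ENNReal.ofReal_mul (waveWeight_pos s b ζ).le,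
    ENNReal.ofReal_pow (norm_nonneg _), ofReal_norm]

theorem l2Size_weightedFourier (s b : ℝ) (f : SchwartzMap SpaceTime ℂ) :
    l2Size volume (weightedFourier s b f) = ENNReal.ofReal (waveNorm s b f) := by
  rw [l2Size, lintegral_weightedFourier_sq, ENNReal.ofReal_rpow_of_nonneg _ (by norm_num)]
  · rfl
  · exact integral_nonneg fun ζ => mul_nonneg (waveWeight_pos s b ζ).le (by positivity)

theorem ENNReal.le_of_sq_le_mul {x y : ℝ≥0∞} (hx : x ≠ ∞) (h : x ^ 2 ≤ x * y) : x ≤ y := by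
  rcases eq_or_ne x 0 with rfl | h0
  · simp
  · rw [sq] at h
    exact (ENNReal.mul_le_mul_iff_right h0 hx).1 h

/-- Product estimate in wave-Sobolev spaces from the boundedness of its trilinear form. -/
theorem waveNorm_mul_le {a γ a₁ b₁ a₂ b₂ : ℝ} (hT : TriBounded volume fun ξ η => ENNReal.ofReal
      (waveWeight a γ ξ * (waveWeight a₁ b₁ (ξ - η))⁻¹ * (waveWeight a₂ b₂ η)⁻¹)) :
    ∃ C > 0, ∀ u v : SchwartzMap SpaceTime ℂ,
      waveNorm a γ (fun x => u x * v x) ≤ C * waveNorm a₁ b₁ u * waveNorm a₂ b₂ v := by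
  obtain ⟨C, hC, hT⟩ := hT
  refine ⟨C.toReal + 1, by positivity, fun u v => ?_⟩
  set W := SchwartzMap.pairing (ContinuousLinearMap.mul ℂ ℂ) u v with hW
  have hWc : (W : SpaceTime → ℂ) = fun x => u x * v x := rfl
  have hnn (s b : ℝ) (f : SpaceTime → ℂ) : 0 ≤ waveNorm s b f :=
    Real.rpow_nonneg (integral_nonneg fun ζ => by positivity) _
  have conv (ξ : SpaceTime) : ‖𝓕 W ξ‖ₑ ≤ ∫⁻ η, ‖𝓕 u (ξ - η)‖ₑ * ‖𝓕 v η‖ₑ := by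
    rw [SchwartzMap.fourier_coe, hWc, fourier_pairing_mul]
    refine (enorm_integral_le_lintegral_enorm _).trans_eq (lintegral_congr fun η => ?_)
    rw [enorm_mul, mul_comm]
  have kernel (ξ η : SpaceTime) : ENNReal.ofReal
      (waveWeight a γ ξ * (waveWeight a₁ b₁ (ξ - η))⁻¹ * (waveWeight a₂ b₂ η)⁻¹) ^ (1 / 2 : ℝ) *
        (weightedFourier a γ W ξ * weightedFourier a₁ b₁ u (ξ - η) * weightedFourier a₂ b₂ v η) =
      weightedFourier a γ W ξ * ENNReal.ofReal (waveWeight a γ ξ) ^ (1 / 2 : ℝ) *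
        (‖𝓕 u (ξ - η)‖ₑ * ‖𝓕 v η‖ₑ) := by
    have h0 := waveWeight_pos a γ ξ
    have h1 := waveWeight_pos a₁ b₁ (ξ - η)
    have h2 := waveWeight_pos a₂ b₂ η
    have e : ENNReal.ofReal (waveWeight a γ ξ) ^ (1 / 2 : ℝ) = ENNReal.ofReal
        (waveWeight a γ ξ * (waveWeight a₁ b₁ (ξ - η))⁻¹ * (waveWeight a₂ b₂ η)⁻¹) ^ (1 / 2 : ℝ) *
        ENNReal.ofReal (waveWeight a₁ b₁ (ξ - η)) ^ (1 / 2 : ℝ) *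
        ENNReal.ofReal (waveWeight a₂ b₂ η) ^ (1 / 2 : ℝ) := by
      rw [← ENNReal.mul_rpow_of_nonneg _ _ (by norm_num),
        ← ENNReal.mul_rpow_of_nonneg _ _ (by norm_num), ← ENNReal.ofReal_mul (by positivity),
        ← ENNReal.ofReal_mul (by positivity)]
      congr 2
      field_simp
    rw [e, weightedFourier, weightedFourier, weightedFourier]
    ring
  have main : l2Size volume (weightedFourier a γ W) ^ 2 ≤ l2Size volume (weightedFourier a γ W) *
      (C * (l2Size volume (weightedFourier a₁ b₁ u) * l2Size volume (weightedFourier a₂ b₂ v))) := by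
    calc l2Size volume (weightedFourier a γ W) ^ 2
        = ∫⁻ ξ, weightedFourier a γ W ξ ^ 2 := l2Size_sq _ _
      _ ≤ ∫⁻ ξ, weightedFourier a γ W ξ * ENNReal.ofReal (waveWeight a γ ξ) ^ (1 / 2 : ℝ) *
            ∫⁻ η, ‖𝓕 u (ξ - η)‖ₑ * ‖𝓕 v η‖ₑ := by
          refine lintegral_mono fun ξ => ?_
          rw [sq]
          nth_rewrite 2 [weightedFourier]
          rw [← mul_assoc]
          gcongr
          exact conv ξ
      _ = triForm volume (fun ξ η => ENNReal.ofReal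
            (waveWeight a γ ξ * (waveWeight a₁ b₁ (ξ - η))⁻¹ * (waveWeight a₂ b₂ η)⁻¹))
            (weightedFourier a γ W) (weightedFourier a₁ b₁ u) (weightedFourier a₂ b₂ v) := by
          refine lintegral_congr fun ξ => ?_
          simp only [kernel]
          rw [lintegral_const_mul]
          have hu := (𝓕 u).continuous
          have hv := (𝓕 v).continuous
          exact (Continuous.enorm (by fun_prop)).measurable.mul (Continuous.enorm hv).measurable
      _ ≤ _ := hT _ _ _ (by fun_prop) (by fun_prop) (by fun_prop)
      _ = _ := by ring
  have fin := ENNReal.le_of_sq_le_mul (by rw [l2Size_weightedFourier]; simp) main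
  simp only [l2Size_weightedFourier] at fin
  rw [← ENNReal.ofReal_toReal hC, ← ENNReal.ofReal_mul (hnn _ _ _),
    ← ENNReal.ofReal_mul ENNReal.toReal_nonneg,
    ENNReal.ofReal_le_ofReal_iff (by have := hnn a₁ b₁ u; have := hnn a₂ b₂ v; positivity)] at fin
  rw [hWc] at fin
  have := mul_nonneg (hnn a₁ b₁ u) (hnn a₂ b₂ v)
  nlinarith

end BilinearEstimate

theorem nullphi_high_estimate_1 (s s' θ₀ θ₁ : ℝ)
    (hs1 : 1/4 < s') (hs2 : s' ≤ 1) (hs3 : 1/2 < s) (hs4 : s ≤ 1)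
    (hs5 : max (3/2 - 2 * s) (s/2 - 1/8) < s') (hs6 : s' < 4 * s - 3/2)
    (hθ0 : 1/2 < θ₀) (hθ0b : θ₀ < 3/4)
    (hθ1 : max (1/2) (1 - s') < θ₁)
    (hθ1b : θ₁ < min (3/4) (min (4 * s - s' - 1) (2 * s - 1/2))) :
    ∃ ε₀ > 0, ∀ ε : ℝ, 0 < ε → ε ≤ ε₀ → ∃ C > 0, ∀ u v : SchwartzMap SpaceTime ℂ,
      waveNorm (s - 1/2) (θ₀ - 1/2 + ε) (fun x => u x * v x) ≤
        C * waveNorm (s - 1/2) θ₀ (fun x => u x) *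
          waveNorm (s' + 1/2) θ₁ (fun x => v x) := by
  refine ⟨3/4 - θ₀, by linarith, fun ε _ hε => ?_⟩
  have hθ₁ : 1/2 < θ₁ := (le_max_left _ _).trans_lt hθ1
  exact waveNorm_mul_le (triBounded_waveWeight (by linarith) (by linarith) (by linarith)
    (by linarith) (by linarith) hθ0 hθ₁ (by linarith))

end
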